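/- There exist constants 0 < β₁ < 1 < β₂ and ε₀ ∈ (0,1) such that for all 0 < ε < ε₀ the following holds: if λ ≤ λ_c(1 − |log β₁|/|log ε|), then F_{ε,λ}[m] ≥ 0 for all m ∈ H¹(𝕋²; S²) with equality exactly for the constant configurations m ≡ e₃ and m ≡ −e₃; whereas if λ ≥ λ_c(1 + |log β₂|/|log ε|), then inf_{m ∈ H¹(𝕋²;S²)} F_{ε,λ}[m] < 0, so that in particular no constant configuration is a global minimizer. -/

import Mathlib

open MeasureTheory Real Filter

noncomputable section

/-- The plane `ℝ²`, modeled as functions `Fin 2 → ℝ`. -/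
abbrev R2 : Type := Fin 2 → ℝ

/-- The target space `ℝ³`. -/
abbrev R3 : Type := Fin 3 → ℝ

/-- A fundamental domain for the unit torus `𝕋² = ℝ²/ℤ²`. -/
def cube : Set R2 := Set.univ.pi fun _ => Set.Ico (0 : ℝ) 1

/-- The Euclidean norm on `ℝ²`. -/
def en2 (z : R2) : ℝ := Real.sqrt (∑ i, z i ^ 2)

/-- The Euclidean norm on `ℝ³`. -/
def en3 (v : R3) : ℝ := Real.sqrt (∑ i, v i ^ 2)

/-- `|∇f(x)|²` for a scalar function. -/
def gradNormSq (f : R2 → ℝ) (x : R2) : ℝ :=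
  ∑ j, (fderiv ℝ f x (Pi.single j 1)) ^ 2

/-- `|∇f(x)|` for a scalar function. -/
def gradNorm (f : R2 → ℝ) (x : R2) : ℝ := Real.sqrt (gradNormSq f x)

/-- `|∇m(x)|²` for a map `m : ℝ² → ℝ³` (Frobenius norm squared). -/
def gradVSq (m : R2 → R3) (x : R2) : ℝ :=
  ∑ j, ∑ i, (fderiv ℝ m x (Pi.single j 1) i) ^ 2

/-- The squared homogeneous `H^{1/2}` seminorm on the torus (real-space formula). -/
def H12 (f : R2 → ℝ) : ℝ :=
  (1 / (4 * π)) * ∫ x in cube, ∫ z : R2, (f (x + z) - f x) ^ 2 / en2 z ^ 3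

/-- A (strong) magnetization in `H¹(𝕋²; S²)`: a continuously differentiable
`ℤ²`-periodic map with values in the unit sphere `S² ⊂ ℝ³`. -/
def Mag (m : R2 → R3) : Prop :=
  ContDiff ℝ 1 m ∧
    (∀ (x : R2) (n : Fin 2 → ℤ), m (x + fun i => (n i : ℝ)) = m x) ∧
    ∀ x, ∑ i, (m x i) ^ 2 = 1

/-- The reduced thin-film energy `F_{ε,λ}`. -/
def Fen (ε lam : ℝ) (m : R2 → R3) : ℝ :=
  (∫ x in cube, (ε / 2 * gradVSq m x + (1 - (m x 2) ^ 2) / (2 * ε)))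
    - lam / |Real.log ε| * H12 (fun x => m x 2)

/-- The north pole `e₃ = (0,0,1)`. -/
def e3 : R3 := ![0, 0, 1]

/-! ### Basic facts -/

lemma measurableSet_cube : MeasurableSet cube :=
  MeasurableSet.univ_pi fun _ => measurableSet_Ico

lemma volume_cube : volume cube = 1 := by
  unfold cube
  rw [Real.volume_pi_Ico]; simp

instance : IsProbabilityMeasure (volume.restrict cube) := ⟨by simp [volume_cube]⟩

lemma en2_nonneg (z : R2) : 0 ≤ en2 z := Real.sqrt_nonneg _

lemma en2_sq (z : R2) : en2 z ^ 2 = z 0 ^ 2 + z 1 ^ 2 := by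
  unfold en2; rw [Real.sq_sqrt (by positivity)]; simp

lemma continuous_en2 : Continuous en2 := by unfold en2; fun_prop

/-- `ℤ²`-periodicity. -/
def Per {α : Type*} (h : R2 → α) : Prop :=
  ∀ (x : R2) (n : Fin 2 → ℤ), h (x + fun i => (n i : ℝ)) = h x

open scoped Pointwise in
lemma lint_shift (h : R2 → ENNReal) (hp : Per h) (a : R2) :
    ∫⁻ x in cube, h (x + a) = ∫⁻ x in cube, h x := by
  have hc : cube = ZSpan.fundamentalDomain (Pi.basisFun ℝ (Fin 2)) := by
    rw [ZSpan.fundamentalDomain_pi_basisFun]; rfl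
  have hF : IsAddFundamentalDomain
      (Submodule.span ℤ (Set.range (Pi.basisFun ℝ (Fin 2)))).toAddSubgroup cube
      (volume : Measure R2) := by
    rw [hc]; exact ZSpan.isAddFundamentalDomain' _ _
  have : Countable (Submodule.span ℤ (Set.range (Pi.basisFun ℝ (Fin 2)))).toAddSubgroup :=
    inferInstanceAs (Countable (Submodule.span ℤ (Set.range (Pi.basisFun ℝ (Fin 2)))))
  have hF2 := hF.vadd_of_comm a
  have key := hF2.setLIntegral_eq hF h (by
    rintro ⟨g, hg⟩ x
    have : ∃ n : Fin 2 → ℤ, g = fun i => (n i : ℝ) := by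
      have := ((Pi.basisFun ℝ (Fin 2)).mem_span_iff_repr_mem ℤ g).1 hg
      choose n hn using this
      exact ⟨n, funext fun i => by simpa using (hn i).symm⟩
    obtain ⟨n, rfl⟩ := this
    change h ((fun i => (n i : ℝ)) + x) = h x
    rw [add_comm]; exact hp x n)
  rw [← key]
  have e : (a +ᵥ cube) = Set.image (fun x => x + a) cube := by
    ext y; simp only [Set.mem_vadd_set, Set.mem_image, vadd_eq_add, add_comm]
  rw [e, ← (measurePreserving_add_right volume a).setLIntegral_comp_emb
    (measurableEmbedding_addRight a)]

lemma lint_two (Φ : R2 → ENNReal) :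
    ∫⁻ z, Φ z = ∫⁻ p : ℝ × ℝ, Φ ![p.1, p.2] := by
  rw [← (volume_preserving_finTwoArrow ℝ).symm.lintegral_comp_emb
    (MeasurableEquiv.finTwoArrow (α := ℝ)).symm.measurableEmbedding]
  rfl

lemma lint_polar (Φ : R2 → ENNReal) (hΦ : Measurable Φ) :
    ∫⁻ z, Φ z = ∫⁻ r in Set.Ioi (0:ℝ), ∫⁻ θ in Set.Ioo (-π) π,
      ENNReal.ofReal r * Φ ![r * cos θ, r * sin θ] := by
  rw [lint_two, ← lintegral_comp_polarCoord_symm, polarCoord_target, Measure.volume_eq_prod,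
    ← Measure.prod_restrict, lintegral_prod]
  · simp [polarCoord]
  · refine Measurable.aemeasurable ?_
    simp only [smul_eq_mul]
    refine Measurable.mul (by fun_prop) (hΦ.comp ?_)
    refine measurable_pi_iff.2 fun i => ?_
    have := continuous_polarCoord_symm
    fin_cases i
    · exact this.measurable.fst
    · exact this.measurable.snd

lemma en2_polar (r θ : ℝ) (hr : 0 < r) : en2 ![r * cos θ, r * sin θ] = r := by
  unfold en2
  rw [show ∑ i, (![r * cos θ, r * sin θ] : R2) i ^ 2 = r ^ 2 by
    simp [Fin.sum_univ_two]; linear_combination r ^ 2 * Real.sin_sq_add_cos_sq θ]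
  exact Real.sqrt_sq hr.le

lemma ofReal_int_le {α : Type*} [MeasurableSpace α] (μ : Measure α) (g : α → ℝ) :
    ENNReal.ofReal (∫ x, g x ∂μ) ≤ ∫⁻ x, ENNReal.ofReal (g x) ∂μ := by
  by_cases hg : Integrable g μ
  · rw [integral_eq_lintegral_pos_part_sub_lintegral_neg_part hg]
    refine le_trans (ENNReal.ofReal_le_ofReal (sub_le_self _ ENNReal.toReal_nonneg)) ?_
    exact ENNReal.ofReal_toReal_le
  · rw [integral_undef hg]; simp

/-- Radial integral helper. -/
lemma lint_radial (S : Set ℝ) (hS : MeasurableSet S) (w : ℝ → ℝ) (hw : Measurable w) :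
    ∫⁻ z in en2 ⁻¹' S, ENNReal.ofReal (w (en2 z)) =
      ENNReal.ofReal (2 * π) * ∫⁻ r in Set.Ioi (0:ℝ) ∩ S, ENNReal.ofReal (r * w r) := by
  have hm : MeasurableSet (en2 ⁻¹' S) := continuous_en2.measurable hS
  rw [← lintegral_indicator hm, lint_polar]
  swap
  · exact (ENNReal.measurable_ofReal.comp (hw.comp continuous_en2.measurable)).indicator hm
  rw [← lintegral_const_mul _ (by fun_prop)]
  rw [Set.inter_comm, ← Measure.restrict_restrict hS, ← lintegral_indicator hS]
  refine setLIntegral_congr_fun measurableSet_Ioi fun r hr => ?_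
  have hr : 0 < r := hr
  have : ∀ θ : ℝ, (en2 ⁻¹' S).indicator (fun z => ENNReal.ofReal (w (en2 z)))
      ![r * cos θ, r * sin θ] = S.indicator (fun r => ENNReal.ofReal (w r)) r := by
    intro θ
    have hmem : ![r * cos θ, r * sin θ] ∈ en2 ⁻¹' S ↔ r ∈ S := by
      rw [Set.mem_preimage, en2_polar r θ hr]
    by_cases h : r ∈ S
    · rw [Set.indicator_of_mem (hmem.2 h), Set.indicator_of_mem h, en2_polar r θ hr]
    · rw [Set.indicator_of_notMem (fun h' => h (hmem.1 h')), Set.indicator_of_notMem h]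
  simp only [this, lintegral_const, Measure.restrict_apply MeasurableSet.univ, Set.univ_inter,
    Real.volume_Ioo]
  by_cases h : r ∈ S
  · simp only [Set.indicator_of_mem h]
    rw [ENNReal.ofReal_mul hr.le, mul_comm]
    congr 2; ring
  · simp [Set.indicator_of_notMem h]

lemma int_abs_cos : ∫ θ in (-π)..π, |cos θ| = 4 := by
  have hp : Function.Periodic (fun θ : ℝ => |cos θ|) (2 * π) := fun x => by simp
  have h1 := hp.intervalIntegral_add_eq (-π) (-(π / 2))
  rw [show -π + 2 * π = π by ring, show -(π/2) + 2 * π = π / 2 + π by ring] at h1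
  rw [h1, ← intervalIntegral.integral_add_adjacent_intervals (b := π / 2)
    (Continuous.intervalIntegrable (by fun_prop) _ _)
    (Continuous.intervalIntegrable (by fun_prop) _ _)]
  have e1 : ∫ θ in (-(π/2))..(π/2), |cos θ| = ∫ θ in (-(π/2))..(π/2), cos θ := by
    refine intervalIntegral.integral_congr fun x hx => ?_
    rw [Set.uIcc_of_le (by linarith [pi_pos])] at hx
    exact abs_of_nonneg (cos_nonneg_of_mem_Icc hx)
  have e2 : ∫ θ in (π/2)..(π/2 + π), |cos θ| = ∫ θ in (π/2)..(π/2 + π), -cos θ := by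
    refine intervalIntegral.integral_congr fun x hx => ?_
    rw [Set.uIcc_of_le (by linarith [pi_pos])] at hx
    exact abs_of_nonpos (cos_nonpos_of_pi_div_two_le_of_le hx.1 (by linarith [hx.2]))
  rw [e1, e2, intervalIntegral.integral_neg, integral_cos, integral_cos, sin_add_pi, sin_neg,
    sin_pi_div_two]
  norm_num

lemma int_abs_trig (a b : ℝ) :
    ∫ θ in (-π)..π, |a * cos θ + b * sin θ| = 4 * √(a ^ 2 + b ^ 2) := by
  set w : ℂ := ⟨a, b⟩ with hw
  have ha : a = ‖w‖ * cos (Complex.arg w) := by rw [Complex.norm_mul_cos_arg]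
  have hb : b = ‖w‖ * sin (Complex.arg w) := by rw [Complex.norm_mul_sin_arg]
  have hn : √(a ^ 2 + b ^ 2) = ‖w‖ := by
    rw [Complex.norm_def, Complex.normSq_apply]; congr 1; simp [hw]; ring
  rw [hn]
  have : ∀ θ : ℝ, |a * cos θ + b * sin θ| = ‖w‖ * |cos (θ - Complex.arg w)| := by
    intro θ
    rw [cos_sub, ← abs_of_nonneg (norm_nonneg w), ← abs_mul]
    congr 1
    linear_combination cos θ * ha + sin θ * hb
  simp only [this]
  rw [intervalIntegral.integral_const_mul,
    intervalIntegral.integral_comp_sub_right (fun θ => |cos θ|)]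
  have hp : Function.Periodic (fun θ : ℝ => |cos θ|) (2 * π) := fun x => by simp
  have h1 := hp.intervalIntegral_add_eq (-π - Complex.arg w) (-π)
  rw [show -π - Complex.arg w + 2 * π = π - Complex.arg w by ring,
    show -π + 2 * π = π by ring] at h1
  rw [h1, int_abs_cos]; ring

lemma lint_abs_trig (a b : ℝ) :
    ∫⁻ θ in Set.Ioo (-π) π, ENNReal.ofReal |a * cos θ + b * sin θ|
      = ENNReal.ofReal (4 * √(a ^ 2 + b ^ 2)) := by
  rw [← int_abs_trig, intervalIntegral.integral_of_le (by linarith [pi_pos]),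
    integral_Ioc_eq_integral_Ioo, ofReal_integral_eq_lintegral_ofReal]
  · exact ((Continuous.integrableOn_Icc (by fun_prop)).mono_set Set.Ioo_subset_Icc_self)
  · exact Eventually.of_forall fun _ => abs_nonneg _

lemma lint_inv (ε : ℝ) (h0 : 0 < ε) (h1 : ε < 1) :
    ∫⁻ r in Set.Ico ε 1, ENNReal.ofReal (1 / r) = ENNReal.ofReal (-Real.log ε) := by
  have : ∫ r in ε..1, 1 / r = -Real.log ε := by
    rw [integral_one_div_of_pos h0 one_pos]; simp
  rw [← this, intervalIntegral.integral_of_le h1.le, integral_Ioc_eq_integral_Ioo,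
    ← integral_Ico_eq_integral_Ioo, ofReal_integral_eq_lintegral_ofReal]
  · have : IntervalIntegrable (fun r : ℝ => 1 / r) volume ε 1 :=
      ContinuousOn.intervalIntegrable (by
        rw [Set.uIcc_of_le h1.le]
        exact continuousOn_const.div continuousOn_id fun x hx => (h0.trans_le hx.1).ne')
    have := (intervalIntegrable_iff_integrableOn_Icc_of_le h1.le).1 this
    exact this.mono_set Set.Ico_subset_Icc_self
  · refine (ae_restrict_iff' measurableSet_Ico).2 (Eventually.of_forall fun x hx => ?_)
    have := h0.trans_le hx.1
    simp only [Pi.zero_apply]; positivity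

lemma lint_annulus (ε a b : ℝ) (h0 : 0 < ε) (h1 : ε < 1) :
    ∫⁻ z in en2 ⁻¹' Set.Ico ε 1, ENNReal.ofReal (|a * z 0 + b * z 1| / en2 z ^ 3)
      = ENNReal.ofReal (-Real.log ε) * ENNReal.ofReal (4 * √(a ^ 2 + b ^ 2)) := by
  have hm : MeasurableSet (en2 ⁻¹' Set.Ico ε 1) := continuous_en2.measurable measurableSet_Ico
  have hen := continuous_en2.measurable
  rw [← lintegral_indicator hm, lint_polar]
  swap
  · refine Measurable.indicator ?_ hm
    fun_prop
  rw [← lint_inv ε h0 h1, ← lintegral_mul_const _ (by fun_prop), ← lint_abs_trig]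
  have hsub : Set.Ico ε 1 = Set.Ico ε 1 ∩ Set.Ioi 0 := by
    symm; exact Set.inter_eq_left.2 fun x hx => h0.trans_le hx.1
  conv_rhs => rw [hsub, ← Measure.restrict_restrict measurableSet_Ico,
    ← lintegral_indicator measurableSet_Ico]
  refine setLIntegral_congr_fun measurableSet_Ioi fun r hr => ?_
  have hr : 0 < r := hr
  by_cases h : r ∈ Set.Ico ε 1
  · simp only [Set.indicator_of_mem h]
    rw [← lintegral_const_mul _ (by fun_prop)]
    refine lintegral_congr fun θ => ?_
    have hmem : ![r * cos θ, r * sin θ] ∈ en2 ⁻¹' Set.Ico ε 1 := by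
      rw [Set.mem_preimage, en2_polar r θ hr]; exact h
    rw [Set.indicator_of_mem hmem, en2_polar r θ hr, ← ENNReal.ofReal_mul hr.le,
      ← ENNReal.ofReal_mul (by positivity)]
    congr 1
    simp only [Matrix.cons_val_zero, Matrix.cons_val_one]
    rw [show a * (r * cos θ) + b * (r * sin θ) = r * (a * cos θ + b * sin θ) by ring, abs_mul,
      abs_of_pos hr]
    field_simp
  · rw [Set.indicator_of_notMem h]
    have : ∀ θ : ℝ, ENNReal.ofReal r * (en2 ⁻¹' Set.Ico ε 1).indicator
        (fun z => ENNReal.ofReal (|a * z 0 + b * z 1| / en2 z ^ 3)) ![r * cos θ, r * sin θ] = 0 := by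
      intro θ
      have hmem : ![r * cos θ, r * sin θ] ∉ en2 ⁻¹' Set.Ico ε 1 := by
        rw [Set.mem_preimage, en2_polar r θ hr]; exact h
      rw [Set.indicator_of_notMem hmem, mul_zero]
    simp only [this, lintegral_zero]

lemma lint_inner (ε : ℝ) :
    ∫⁻ z in en2 ⁻¹' Set.Iio ε, ENNReal.ofReal (1 / en2 z) = ENNReal.ofReal (2 * π * ε) := by
  rw [lint_radial (Set.Iio ε) measurableSet_Iio (fun r => 1 / r) (by fun_prop),
    ENNReal.ofReal_mul (p := 2 * π) (by positivity)]
  congr 1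
  rw [Set.Ioi_inter_Iio, setLIntegral_congr_fun measurableSet_Ioo (g := fun _ => 1)]
  · simp
  · intro r hr
    have : 0 < r := hr.1
    simp [this.ne']

lemma lint_outer :
    ∫⁻ z in en2 ⁻¹' Set.Ici 1, ENNReal.ofReal (1 / en2 z ^ 3) = ENNReal.ofReal (2 * π) := by
  rw [lint_radial (Set.Ici 1) measurableSet_Ici (fun r => 1 / r ^ 3) (by fun_prop)]
  have : ∫⁻ r in Set.Ioi (0:ℝ) ∩ Set.Ici 1, ENNReal.ofReal (r * (1 / r ^ 3)) = 1 := by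
    have e : Set.Ioi (0:ℝ) ∩ Set.Ici 1 = Set.Ici 1 :=
      Set.inter_eq_right.2 fun x (hx : 1 ≤ x) => (lt_of_lt_of_le one_pos hx : 0 < x)
    rw [e, setLIntegral_congr Ioi_ae_eq_Ici.symm]
    have h2 : ∫ r in Set.Ioi (1:ℝ), r ^ (-2:ℝ) = 1 := by
      rw [integral_Ioi_rpow_of_lt (by norm_num) one_pos]; norm_num
    have h3 : (1 : ENNReal) = ENNReal.ofReal (∫ r in Set.Ioi (1:ℝ), r ^ (-2:ℝ)) := by
      rw [h2, ENNReal.ofReal_one]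
    rw [h3, ofReal_integral_eq_lintegral_ofReal]
    · refine setLIntegral_congr_fun measurableSet_Ioi fun r hr => ?_
      have hr : 0 < r := one_pos.trans hr
      congr 1
      rw [rpow_neg hr.le, rpow_two]; field_simp
    · exact integrableOn_Ioi_rpow_of_lt (by norm_num) one_pos
    · refine (ae_restrict_iff' measurableSet_Ioi).2 (Eventually.of_forall fun x (hx : 1 < x) => ?_)
      have : 0 < x := one_pos.trans hx
      simp only [Pi.zero_apply]; positivity
  rw [this, mul_one]

/-- `H^{1/2}` double integral as a lower Lebesgue integral. -/
def HL (f : R2 → ℝ) : ENNReal :=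
  ∫⁻ x in cube, ∫⁻ z : R2, ENNReal.ofReal ((f (x + z) - f x) ^ 2 / en2 z ^ 3)

lemma fderiv_app (f : R2 → ℝ) (x z : R2) :
    fderiv ℝ f x z = fderiv ℝ f x (Pi.single 0 1) * z 0 + fderiv ℝ f x (Pi.single 1 1) * z 1 := by
  have : z = z 0 • (Pi.single 0 1 : R2) + z 1 • (Pi.single 1 1 : R2) := by
    ext i; fin_cases i <;> simp
  conv_lhs => rw [this, map_add, map_smul, map_smul]
  simp only [smul_eq_mul]; ring

lemma gradNormSq_eq (f : R2 → ℝ) (x : R2) : gradNormSq f x =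
    fderiv ℝ f x (Pi.single 0 1) ^ 2 + fderiv ℝ f x (Pi.single 1 1) ^ 2 := by
  simp [gradNormSq]

lemma abs_fderiv_le (f : R2 → ℝ) (x z : R2) : |fderiv ℝ f x z| ≤ gradNorm f x * en2 z := by
  rw [gradNorm, en2, ← Real.sqrt_mul (by rw [gradNormSq_eq]; positivity)]
  refine Real.abs_le_sqrt ?_
  rw [fderiv_app, gradNormSq_eq]
  simp only [Fin.sum_univ_two]
  nlinarith [sq_nonneg (fderiv ℝ f x (Pi.single 0 1) * z 1 - fderiv ℝ f x (Pi.single 1 1) * z 0)]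


lemma cont_fd {f : R2 → ℝ} (hf : ContDiff ℝ 1 f) (v : R2) : Continuous fun x => fderiv ℝ f x v :=
  (hf.continuous_fderiv one_ne_zero).clm_apply continuous_const

lemma cont_gns {f : R2 → ℝ} (hf : ContDiff ℝ 1 f) : Continuous (gradNormSq f) := by
  unfold gradNormSq
  exact continuous_finsetSum _ fun j _ => (cont_fd hf _).pow 2

lemma cont_gn {f : R2 → ℝ} (hf : ContDiff ℝ 1 f) : Continuous (gradNorm f) := (cont_gns hf).sqrt

lemma ftc {f : R2 → ℝ} (hf : ContDiff ℝ 1 f) (x z : R2) : f (x + z) - f x = ∫ t in (0:ℝ)..1, fderiv ℝ f (x + t • z) z := by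
  have h : ∀ t : ℝ, HasDerivAt (fun t : ℝ => f (x + t • z)) (fderiv ℝ f (x + t • z) z) t := by
    intro t
    have h1 := ((hf.differentiable one_ne_zero) (x + t • z)).hasFDerivAt
    have h2 : HasDerivAt (fun t : ℝ => x + t • z) z t := by
      simpa using ((hasDerivAt_id t).smul_const z).const_add x
    exact h1.comp_hasDerivAt t h2
  rw [intervalIntegral.integral_eq_sub_of_hasDerivAt (fun t _ => h t)]
  · simp
  · refine Continuous.intervalIntegrable ?_ _ _
    exact (cont_fd hf z).comp (by fun_prop)

lemma per_fderiv {f : R2 → ℝ} (hp : Per f) : Per (fderiv ℝ f) := by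
  intro x n
  rw [← fderiv_comp_add_right]
  congr 1
  ext y; exact hp y n

lemma shift_bound {f : R2 → ℝ} (hf : ContDiff ℝ 1 f) (hp : Per f) (φ : ℝ → ENNReal) (hφ : Measurable φ)
    (hJ : ∀ g : ℝ → ℝ, Continuous g → φ (∫ t in (0:ℝ)..1, g t) ≤
      ∫⁻ t in Set.Ioc (0:ℝ) 1, φ (g t)) (z : R2) :
    ∫⁻ x in cube, φ (f (x + z) - f x) ≤ ∫⁻ x in cube, φ (fderiv ℝ f x z) := by
  have hc := cont_fd hf z
  calc ∫⁻ x in cube, φ (f (x + z) - f x)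
      ≤ ∫⁻ x in cube, ∫⁻ t in Set.Ioc (0:ℝ) 1, φ (fderiv ℝ f (x + t • z) z) := by
        refine lintegral_mono fun x => ?_
        simp only
        rw [ftc hf]
        exact hJ _ (hc.comp (by fun_prop))
    _ = ∫⁻ t in Set.Ioc (0:ℝ) 1, ∫⁻ x in cube, φ (fderiv ℝ f (x + t • z) z) := by
        refine lintegral_lintegral_swap ?_
        refine Measurable.aemeasurable ?_
        exact hφ.comp (hc.comp (by fun_prop : Continuous fun p : R2 × ℝ => p.1 + p.2 • z)).measurable
    _ = ∫⁻ t in Set.Ioc (0:ℝ) 1, ∫⁻ x in cube, φ (fderiv ℝ f x z) := by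
        refine lintegral_congr fun t => ?_
        refine lint_shift (fun x => φ (fderiv ℝ f x z)) ?_ (t • z)
        intro x n
        simp only [per_fderiv hp x n]
    _ = _ := by simp

lemma D1_bound {f : R2 → ℝ} (hf : ContDiff ℝ 1 f) (hp : Per f) (z : R2) : ∫⁻ x in cube, ENNReal.ofReal |f (x + z) - f x| ≤
    ∫⁻ x in cube, ENNReal.ofReal |fderiv ℝ f x z| := by
  refine shift_bound hf hp (fun s => ENNReal.ofReal |s|) (by fun_prop) ?_ z
  intro g hg
  rw [← ofReal_integral_eq_lintegral_ofReal
    (hg.abs.integrableOn_Icc.mono_set Set.Ioc_subset_Icc_self)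
    (Eventually.of_forall fun _ => abs_nonneg _)]
  refine ENNReal.ofReal_le_ofReal ?_
  rw [intervalIntegral.integral_of_le zero_le_one]
  exact abs_integral_le_integral_abs

lemma D2_bound {f : R2 → ℝ} (hf : ContDiff ℝ 1 f) (hp : Per f) (z : R2) : ∫⁻ x in cube, ENNReal.ofReal ((f (x + z) - f x) ^ 2) ≤
    ∫⁻ x in cube, ENNReal.ofReal ((fderiv ℝ f x z) ^ 2) := by
  refine shift_bound hf hp (fun s => ENNReal.ofReal (s ^ 2)) (by fun_prop) ?_ z
  intro g hg
  have hg2 : Continuous fun t => g t ^ 2 := hg.pow 2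
  rw [← ofReal_integral_eq_lintegral_ofReal
    (hg2.integrableOn_Icc.mono_set Set.Ioc_subset_Icc_self)
    (Eventually.of_forall fun _ => sq_nonneg _)]
  refine ENNReal.ofReal_le_ofReal ?_
  rw [← intervalIntegral.integral_of_le zero_le_one]
  set c := ∫ t in (0:ℝ)..1, g t with hc
  have hi : ∀ h : ℝ → ℝ, Continuous h → IntervalIntegrable h volume 0 1 :=
    fun h hh => hh.intervalIntegrable _ _
  have h0 : 0 ≤ ∫ t in (0:ℝ)..1, (g t - c) ^ 2 :=
    intervalIntegral.integral_nonneg zero_le_one fun _ _ => sq_nonneg _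
  have h1 : ∫ t in (0:ℝ)..1, (g t - c) ^ 2 = (∫ t in (0:ℝ)..1, g t ^ 2) - 2 * c * c + c ^ 2 := by
    have : ∀ t, (g t - c) ^ 2 = g t ^ 2 - 2 * c * g t + c ^ 2 := fun t => by ring
    simp only [this]
    rw [intervalIntegral.integral_add (hi _ (by fun_prop)) (hi _ (by fun_prop)),
      intervalIntegral.integral_sub (hi _ (by fun_prop)) (hi _ (by fun_prop)),
      intervalIntegral.integral_const_mul, ← hc]
    simp
  nlinarith

lemma D1_global {f : R2 → ℝ} (hf : ContDiff ℝ 1 f) (hp : Per f) (z : R2) : ∫⁻ x in cube, ENNReal.ofReal |f (x + z) - f x| ≤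
    ENNReal.ofReal (√2) * ∫⁻ x in cube, ENNReal.ofReal (gradNorm f x) := by
  set w : R2 := fun i => Int.fract (z i) with hw
  have hz : ∀ x, f (x + z) = f (x + w) := by
    intro x
    have := hp (x + w) (fun i => ⌊z i⌋)
    rw [← this]
    congr 1
    ext i
    simp only [Pi.add_apply, hw]
    rw [add_assoc, Int.fract_add_floor]
  simp only [hz]
  refine (D1_bound hf hp w).trans ?_
  rw [← lintegral_const_mul _ (cont_gn hf).measurable.ennreal_ofReal]
  refine lintegral_mono fun x => ?_
  simp only
  rw [← ENNReal.ofReal_mul (by positivity)]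
  refine ENNReal.ofReal_le_ofReal ((abs_fderiv_le f x w).trans ?_)
  rw [mul_comm]
  refine mul_le_mul_of_nonneg_right ?_ (Real.sqrt_nonneg _)
  refine Real.sqrt_le_sqrt ?_
  simp only [Fin.sum_univ_two, hw]
  have h0 := Int.fract_nonneg (z 0)
  have h1 := Int.fract_nonneg (z 1)
  nlinarith [(Int.fract_lt_one (z 0)).le, (Int.fract_lt_one (z 1)).le]

lemma ker_split (d e : ℝ) (he : 0 ≤ e) :
    ENNReal.ofReal (d / e ^ 3) = ENNReal.ofReal (1 / e ^ 3) * ENNReal.ofReal d := by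
  rw [← ENNReal.ofReal_mul (by positivity)]; congr 1; ring

lemma meas_ker {f : R2 → ℝ} (hf : Continuous f) :
    Measurable fun p : R2 × R2 => ENNReal.ofReal ((f (p.1 + p.2) - f p.1) ^ 2 / en2 p.2 ^ 3) := by
  have := continuous_en2.measurable
  have := hf.measurable
  fun_prop

lemma HL_swap {f : R2 → ℝ} (hf : Continuous f) :
    HL f = ∫⁻ z : R2, ENNReal.ofReal (1 / en2 z ^ 3) *
      ∫⁻ x in cube, ENNReal.ofReal ((f (x + z) - f x) ^ 2) := by
  unfold HL
  rw [lintegral_lintegral_swap (meas_ker hf).aemeasurable]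
  refine lintegral_congr fun z => ?_
  have := hf.measurable
  rw [← lintegral_const_mul _ (by fun_prop)]
  exact lintegral_congr fun x => ker_split _ _ (en2_nonneg z)

lemma D2_le_D1 {f : R2 → ℝ} (hf : Continuous f) (hb : ∀ x, |f x| ≤ 1) (z : R2) :
    ∫⁻ x in cube, ENNReal.ofReal ((f (x + z) - f x) ^ 2) ≤
      ENNReal.ofReal 2 * ∫⁻ x in cube, ENNReal.ofReal |f (x + z) - f x| := by
  have := hf.measurable
  rw [← lintegral_const_mul _ (by fun_prop)]
  refine lintegral_mono fun x => ?_
  simp only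
  rw [← ENNReal.ofReal_mul (by norm_num)]
  refine ENNReal.ofReal_le_ofReal ?_
  have h1 := abs_le.1 (hb (x + z))
  have h2 := abs_le.1 (hb x)
  have h3 : |f (x + z) - f x| ≤ 2 := abs_le.2 ⟨by linarith, by linarith⟩
  rw [← sq_abs, sq]
  exact mul_le_mul_of_nonneg_right h3 (abs_nonneg _)

lemma HL_le {f : R2 → ℝ} (hf : ContDiff ℝ 1 f) (hp : Per f) (hb : ∀ x, |f x| ≤ 1)
    (ε : ℝ) (h0 : 0 < ε) (h1 : ε < 1) :
    HL f ≤ ENNReal.ofReal (2 * π * ε) * (∫⁻ x in cube, ENNReal.ofReal (gradNormSq f x))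
      + ENNReal.ofReal (8 * -Real.log ε) * (∫⁻ x in cube, ENNReal.ofReal (gradNorm f x))
      + ENNReal.ofReal (4 * √2 * π) * (∫⁻ x in cube, ENNReal.ofReal (gradNorm f x)) := by
  have hen := continuous_en2.measurable
  have hL : 0 < -Real.log ε := by have := Real.log_neg h0 h1; linarith
  rw [HL_swap hf.continuous]
  set K : R2 → ENNReal := fun z => ENNReal.ofReal (1 / en2 z ^ 3) *
      ∫⁻ x in cube, ENNReal.ofReal ((f (x + z) - f x) ^ 2) with hK
  have hcov : (Set.univ : Set R2) = (en2 ⁻¹' Set.Iio ε ∪ en2 ⁻¹' Set.Ico ε 1) ∪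
      en2 ⁻¹' Set.Ici 1 := by
    symm; rw [Set.eq_univ_iff_forall]
    intro z
    simp only [Set.mem_union, Set.mem_preimage, Set.mem_Iio, Set.mem_Ico, Set.mem_Ici]
    rcases lt_or_ge (en2 z) ε with h | h
    · exact Or.inl (Or.inl h)
    · rcases lt_or_ge (en2 z) 1 with h' | h'
      · exact Or.inl (Or.inr ⟨h, h'⟩)
      · exact Or.inr h'
  have hsplit : ∫⁻ z, K z ≤ (∫⁻ z in en2 ⁻¹' Set.Iio ε, K z) + (∫⁻ z in en2 ⁻¹' Set.Ico ε 1, K z)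
      + ∫⁻ z in en2 ⁻¹' Set.Ici 1, K z := by
    rw [← setLIntegral_univ, hcov]
    refine (lintegral_union_le _ _ _).trans ?_
    gcongr
    exact lintegral_union_le _ _ _
  refine hsplit.trans ?_
  have A : ∫⁻ z in en2 ⁻¹' Set.Iio ε, K z ≤
      ENNReal.ofReal (2 * π * ε) * (∫⁻ x in cube, ENNReal.ofReal (gradNormSq f x)) := by
    rw [← lint_inner, ← lintegral_mul_const _ (by fun_prop)]
    refine lintegral_mono fun z => ?_
    have e : ENNReal.ofReal (1 / en2 z) =
        ENNReal.ofReal (1 / en2 z ^ 3) * ENNReal.ofReal (en2 z ^ 2) := by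
      have := en2_nonneg z
      rw [← ENNReal.ofReal_mul (by positivity)]
      congr 1
      rcases this.eq_or_lt with h | h
      · simp [← h]
      · field_simp
    simp only [hK]
    rw [e, mul_assoc]
    refine mul_le_mul_right ((D2_bound hf hp z).trans ?_) _
    rw [← lintegral_const_mul _ (cont_gns hf).measurable.ennreal_ofReal]
    refine lintegral_mono fun x => ?_
    simp only
    rw [← ENNReal.ofReal_mul (by positivity)]
    refine ENNReal.ofReal_le_ofReal ?_
    have h := abs_fderiv_le f x z
    have h2 : gradNorm f x ^ 2 = gradNormSq f x :=
      Real.sq_sqrt (by rw [gradNormSq_eq]; positivity)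
    rw [← sq_abs, ← h2, ← mul_pow, mul_comm]
    exact pow_le_pow_left₀ (abs_nonneg _) h 2
  have B : ∫⁻ z in en2 ⁻¹' Set.Ico ε 1, K z ≤
      ENNReal.ofReal (8 * -Real.log ε) * (∫⁻ x in cube, ENNReal.ofReal (gradNorm f x)) := by
    have hm : Measurable fun p : R2 × R2 =>
        ENNReal.ofReal (|fderiv ℝ f p.2 (Pi.single 0 1) * p.1 0 +
            fderiv ℝ f p.2 (Pi.single 1 1) * p.1 1| / en2 p.1 ^ 3) := by
      have e1 := (cont_fd hf (Pi.single 0 1)).measurable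
      have e2 := (cont_fd hf (Pi.single 1 1)).measurable
      fun_prop
    calc ∫⁻ z in en2 ⁻¹' Set.Ico ε 1, K z
        ≤ ∫⁻ z in en2 ⁻¹' Set.Ico ε 1, ENNReal.ofReal 2 * ∫⁻ x in cube,
          ENNReal.ofReal (|fderiv ℝ f x (Pi.single 0 1) * z 0 +
            fderiv ℝ f x (Pi.single 1 1) * z 1| / en2 z ^ 3) := by
          refine lintegral_mono fun z => ?_
          have hh : ∀ x, ENNReal.ofReal (|fderiv ℝ f x (Pi.single 0 1) * z 0 +
              fderiv ℝ f x (Pi.single 1 1) * z 1| / en2 z ^ 3) =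
              ENNReal.ofReal (1 / en2 z ^ 3) * ENNReal.ofReal |fderiv ℝ f x z| := fun x => by
            rw [← fderiv_app]; exact ker_split _ _ (en2_nonneg z)
          simp only [hK, hh]
          have := (cont_fd hf z).measurable
          rw [lintegral_const_mul _ (by fun_prop), mul_left_comm]
          refine mul_le_mul_right ((D2_le_D1 hf.continuous hb z).trans ?_) _
          exact mul_le_mul_right (D1_bound hf hp z) _
      _ = ENNReal.ofReal 2 * ∫⁻ x in cube, ∫⁻ z in en2 ⁻¹' Set.Ico ε 1,
          ENNReal.ofReal (|fderiv ℝ f x (Pi.single 0 1) * z 0 +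
            fderiv ℝ f x (Pi.single 1 1) * z 1| / en2 z ^ 3) := by
          rw [lintegral_const_mul', lintegral_lintegral_swap hm.aemeasurable]
          exact ENNReal.ofReal_ne_top
      _ = ENNReal.ofReal 2 * ∫⁻ x in cube, ENNReal.ofReal (-Real.log ε) *
            ENNReal.ofReal (4 * gradNorm f x) := by
          congr 1
          refine lintegral_congr fun x => ?_
          rw [lint_annulus ε _ _ h0 h1, gradNorm, gradNormSq_eq]
      _ = _ := by
          have := (cont_gn hf).measurable
          rw [← lintegral_const_mul _ (by fun_prop), ← lintegral_const_mul _ (by fun_prop)]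
          refine lintegral_congr fun x => ?_
          rw [← ENNReal.ofReal_mul hL.le, ← ENNReal.ofReal_mul (by norm_num),
            ← ENNReal.ofReal_mul (by positivity)]
          congr 1; ring
  have C : ∫⁻ z in en2 ⁻¹' Set.Ici 1, K z ≤
      ENNReal.ofReal (4 * √2 * π) * (∫⁻ x in cube, ENNReal.ofReal (gradNorm f x)) := by
    have e : ENNReal.ofReal (4 * √2 * π) = ENNReal.ofReal (2 * π) *
        (ENNReal.ofReal 2 * ENNReal.ofReal (√2)) := by
      rw [← ENNReal.ofReal_mul (by norm_num), ← ENNReal.ofReal_mul (by positivity)]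
      congr 1; ring
    rw [e, ← lint_outer, mul_assoc, ← lintegral_mul_const _ (by fun_prop)]
    refine lintegral_mono fun z => ?_
    simp only [hK]
    refine mul_le_mul_right ((D2_le_D1 hf.continuous hb z).trans ?_) _
    rw [mul_assoc]
    exact mul_le_mul_right (D1_global hf hp z) _
  exact add_le_add (add_le_add A B) C

lemma integrable_cube {g : R2 → ℝ} (hg : Continuous g) : IntegrableOn g cube := by
  refine (hg.integrableOn_Icc (a := 0) (b := 1)).mono_set ?_
  intro x hx
  exact ⟨fun i => (hx i trivial).1, fun i => (hx i trivial).2.le⟩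

lemma H12_eq {f : R2 → ℝ} (hf : Continuous f) (hfin : HL f ≠ ⊤) :
    H12 f = (1 / (4 * π)) * (HL f).toReal := by
  unfold H12
  congr 1
  have hker : ∀ x z : R2, 0 ≤ (f (x + z) - f x) ^ 2 / en2 z ^ 3 := fun x z => by
    have := en2_nonneg z
    positivity
  have hm := meas_ker hf
  have hmr : Measurable fun p : R2 × R2 => (f (p.1 + p.2) - f p.1) ^ 2 / en2 p.2 ^ 3 := by
    have := continuous_en2.measurable
    have := hf.measurable
    fun_prop
  have hin : ∀ x : R2, ∫ z : R2, (f (x + z) - f x) ^ 2 / en2 z ^ 3 =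
      (∫⁻ z : R2, ENNReal.ofReal ((f (x + z) - f x) ^ 2 / en2 z ^ 3)).toReal := by
    intro x
    refine integral_eq_lintegral_of_nonneg_ae (Eventually.of_forall fun z => hker x z) ?_
    exact (hmr.comp measurable_prodMk_left).aestronglyMeasurable
  simp only [hin]
  have hG : Measurable fun x : R2 => ∫⁻ z : R2, ENNReal.ofReal ((f (x + z) - f x) ^ 2 / en2 z ^ 3) :=
    hm.lintegral_prod_right'
  rw [integral_toReal hG.aemeasurable (ae_lt_top hG hfin)]
  rfl

/-- The real form of the upper bound. -/
lemma HL_real {f : R2 → ℝ} (hf : ContDiff ℝ 1 f) (hp : Per f) (hb : ∀ x, |f x| ≤ 1)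
    (ε : ℝ) (h0 : 0 < ε) (h1 : ε < 1) :
    HL f ≤ ENNReal.ofReal (2 * π * ε * (∫ x in cube, gradNormSq f x)
      + (8 * -Real.log ε + 4 * √2 * π) * ∫ x in cube, gradNorm f x) := by
  refine (HL_le hf hp hb ε h0 h1).trans (le_of_eq ?_)
  have hL : 0 < -Real.log ε := by have := Real.log_neg h0 h1; linarith
  have n1 : ∀ x, 0 ≤ gradNormSq f x := fun x => by rw [gradNormSq_eq]; positivity
  have n2 : ∀ x, 0 ≤ gradNorm f x := fun x => Real.sqrt_nonneg _
  have i1 : 0 ≤ ∫ x in cube, gradNormSq f x := integral_nonneg n1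
  have i2 : 0 ≤ ∫ x in cube, gradNorm f x := integral_nonneg n2
  rw [← ofReal_integral_eq_lintegral_ofReal (integrable_cube (cont_gns hf))
    (Eventually.of_forall n1), ← ofReal_integral_eq_lintegral_ofReal (integrable_cube (cont_gn hf))
    (Eventually.of_forall n2), ← ENNReal.ofReal_mul (by positivity),
    ← ENNReal.ofReal_mul (by positivity), ← ENNReal.ofReal_mul (by positivity),
    ← ENNReal.ofReal_add (by positivity) (by positivity),
    ← ENNReal.ofReal_add (by positivity) (by positivity)]
  congr 1; ring

/-- The local part of the energy. -/
def Eloc (ε : ℝ) (m : R2 → R3) : ℝ :=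
  ∫ x in cube, (ε / 2 * gradVSq m x + (1 - (m x 2) ^ 2) / (2 * ε))

lemma Mag.contDiff {m : R2 → R3} (hm : Mag m) (i : Fin 3) : ContDiff ℝ 1 fun x => m x i :=
  contDiff_pi.1 hm.1 i

lemma Mag.per {m : R2 → R3} (hm : Mag m) (i : Fin 3) : Per fun x => m x i :=
  fun x n => by simp only [hm.2.1 x n]

lemma Mag.sum {m : R2 → R3} (hm : Mag m) (x : R2) : m x 0 ^ 2 + m x 1 ^ 2 + m x 2 ^ 2 = 1 := by
  simpa [Fin.sum_univ_three] using hm.2.2 x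

lemma Mag.bound {m : R2 → R3} (hm : Mag m) (x : R2) : |m x 2| ≤ 1 := by
  rw [← sq_le_one_iff_abs_le_one]
  nlinarith [hm.sum x, sq_nonneg (m x 0), sq_nonneg (m x 1)]

lemma Mag.fd {m : R2 → R3} (hm : Mag m) (x v : R2) (i : Fin 3) :
    fderiv ℝ m x v i = fderiv ℝ (fun x => m x i) x v := by
  have h := (hm.1.differentiable one_ne_zero x).hasFDerivAt
  have h2 := (hasFDerivAt_pi'.1 h) i
  rw [h2.fderiv]; rfl

lemma Mag.orth {m : R2 → R3} (hm : Mag m) (x v : R2) :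
    m x 0 * fderiv ℝ m x v 0 + m x 1 * fderiv ℝ m x v 1 + m x 2 * fderiv ℝ m x v 2 = 0 := by
  have h := (hm.1.differentiable one_ne_zero x).hasFDerivAt
  have h2 := fun i => (hasFDerivAt_pi'.1 h) i
  have h3 := (((h2 0).pow 2).add ((h2 1).pow 2)).add ((h2 2).pow 2)
  have hfun : ((fun y => m y 0) ^ 2 + (fun y => m y 1) ^ 2 + (fun y => m y 2) ^ 2) =
      fun _ : R2 => (1:ℝ) := by
    ext y; simpa using hm.sum y
  have h4 := h3.unique (by
    have := hasFDerivAt_const (𝕜 := ℝ) (1:ℝ) x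
    rw [← hfun] at this
    exact this)
  have h5 := congrArg (fun L => L v) h4
  simp at h5
  linarith

lemma Mag.pt {m : R2 → R3} (hm : Mag m) (x v : R2) :
    (fderiv ℝ (fun x => m x 2) x v) ^ 2 ≤ (1 - m x 2 ^ 2) * ∑ i, (fderiv ℝ m x v i) ^ 2 := by
  rw [← hm.fd, Fin.sum_univ_three]
  have h1 := hm.orth x v
  have h2 := hm.sum x
  generalize fderiv ℝ m x v 0 = a at *
  generalize fderiv ℝ m x v 1 = b at *
  generalize fderiv ℝ m x v 2 = c at *
  generalize m x 0 = p at *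
  generalize m x 1 = q at *
  generalize m x 2 = r at *
  have e1 : (r * c) ^ 2 = (p * a + q * b) ^ 2 := by
    rw [show r * c = -(p * a + q * b) by linarith]; ring
  have e2 : 1 - r ^ 2 = p ^ 2 + q ^ 2 := by linarith
  have e3 : c ^ 2 = (r * c) ^ 2 + (p ^ 2 + q ^ 2) * c ^ 2 := by rw [← e2]; ring
  rw [e2, e3, e1]
  nlinarith [sq_nonneg (p * b - q * a)]

lemma Mag.gns_le {m : R2 → R3} (hm : Mag m) (x : R2) :
    gradNormSq (fun x => m x 2) x ≤ (1 - m x 2 ^ 2) * gradVSq m x := by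
  unfold gradNormSq gradVSq
  rw [Finset.mul_sum]
  exact Finset.sum_le_sum fun j _ => hm.pt x _

lemma gradVSq_nonneg (m : R2 → R3) (x : R2) : 0 ≤ gradVSq m x := by
  unfold gradVSq; positivity

lemma Mag.one_sub {m : R2 → R3} (hm : Mag m) (x : R2) : 0 ≤ 1 - m x 2 ^ 2 := by
  nlinarith [hm.sum x, sq_nonneg (m x 0), sq_nonneg (m x 1)]

lemma Mag.gns_le' {m : R2 → R3} (hm : Mag m) (x : R2) :
    gradNormSq (fun x => m x 2) x ≤ gradVSq m x := by
  refine (hm.gns_le x).trans ?_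
  nlinarith [gradVSq_nonneg m x, sq_nonneg (m x 2), mul_nonneg (sq_nonneg (m x 2)) (gradVSq_nonneg m x)]

lemma Mag.gn_le {m : R2 → R3} (hm : Mag m) (ε : ℝ) (h0 : 0 < ε) (x : R2) :
    gradNorm (fun x => m x 2) x ≤ ε / 2 * gradVSq m x + (1 - (m x 2) ^ 2) / (2 * ε) := by
  have h1 := hm.gns_le x
  have h2 := gradVSq_nonneg m x
  have h3 := hm.one_sub x
  rw [gradNorm]
  refine Real.sqrt_le_iff.2 ⟨by positivity, h1.trans ?_⟩
  have e : (1 - m x 2 ^ 2) * gradVSq m x =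
      4 * (ε / 2 * gradVSq m x) * ((1 - (m x 2) ^ 2) / (2 * ε)) := by
    field_simp; ring
  rw [e]
  nlinarith [sq_nonneg (ε / 2 * gradVSq m x - (1 - (m x 2) ^ 2) / (2 * ε))]

lemma Mag.cont_gv {m : R2 → R3} (hm : Mag m) : Continuous (gradVSq m) := by
  unfold gradVSq
  refine continuous_finsetSum _ fun j _ => continuous_finsetSum _ fun i _ => ?_
  have : (fun x => fderiv ℝ m x (Pi.single j 1) i ^ 2) =
      fun x => fderiv ℝ (fun x => m x i) x (Pi.single j 1) ^ 2 := by
    ext x; rw [hm.fd]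
  rw [this]
  exact (cont_fd (hm.contDiff i) _).pow 2

lemma Mag.cont_dens {m : R2 → R3} (hm : Mag m) (ε : ℝ) :
    Continuous fun x => ε / 2 * gradVSq m x + (1 - (m x 2) ^ 2) / (2 * ε) := by
  have := hm.cont_gv
  have := (hm.contDiff 2).continuous
  fun_prop

lemma Mag.HL_fin {m : R2 → R3} (hm : Mag m) : HL (fun x => m x 2) ≠ ⊤ :=
  ne_top_of_le_ne_top ENNReal.ofReal_ne_top
    (HL_real (hm.contDiff 2) (hm.per 2) hm.bound (1/2) (by norm_num) (by norm_num))

lemma Mag.E_nonneg {m : R2 → R3} (hm : Mag m) (ε : ℝ) (h0 : 0 < ε) : 0 ≤ Eloc ε m := by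
  refine integral_nonneg fun x => ?_
  have h2 := gradVSq_nonneg m x
  have h3 := hm.one_sub x
  simp only [Pi.zero_apply]
  positivity

lemma Mag.H12_le {m : R2 → R3} (hm : Mag m) (ε : ℝ) (h0 : 0 < ε) (h1 : ε < 1) :
    H12 (fun x => m x 2) ≤ 2 / π * (-Real.log ε + 4) * Eloc ε m := by
  rw [H12_eq (hm.contDiff 2).continuous hm.HL_fin]
  have hL : 0 < -Real.log ε := by have := Real.log_neg h0 h1; linarith
  have hE := hm.E_nonneg ε h0
  have i1 : ε / 2 * (∫ x in cube, gradNormSq (fun x => m x 2) x) ≤ Eloc ε m := by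
    rw [← integral_const_mul]
    refine integral_mono ((integrable_cube (cont_gns (hm.contDiff 2))).const_mul _)
      (integrable_cube (hm.cont_dens ε)) fun x => ?_
    have h2 := hm.gns_le' x
    have h3 := hm.one_sub x
    have h4 : 0 ≤ (1 - (m x 2) ^ 2) / (2 * ε) := by positivity
    simp only
    nlinarith
  have i2 : (∫ x in cube, gradNorm (fun x => m x 2) x) ≤ Eloc ε m :=
    integral_mono (integrable_cube (cont_gn (hm.contDiff 2)))
      (integrable_cube (hm.cont_dens ε)) fun x => hm.gn_le ε h0 x
  have h := ENNReal.toReal_le_of_le_ofReal ?_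
    (HL_real (hm.contDiff 2) (hm.per 2) hm.bound ε h0 h1)
  swap
  · have n1 : ∀ x, 0 ≤ gradNormSq (fun x => m x 2) x := fun x => by rw [gradNormSq_eq]; positivity
    have n2 : ∀ x, 0 ≤ gradNorm (fun x => m x 2) x := fun x => Real.sqrt_nonneg _
    have i1 : 0 ≤ ∫ x in cube, gradNormSq (fun x => m x 2) x := integral_nonneg n1
    have i2 : 0 ≤ ∫ x in cube, gradNorm (fun x => m x 2) x := integral_nonneg n2
    positivity
  have hpi := pi_pos
  have h2 : (HL fun x => m x 2).toReal ≤ (4 * π + 8 * -Real.log ε + 4 * √2 * π) * Eloc ε m := by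
    refine h.trans ?_
    have t1 := mul_le_mul_of_nonneg_left i1 (by positivity : (0:ℝ) ≤ 4 * π)
    have t2 := mul_le_mul_of_nonneg_left i2
      (by positivity : 0 ≤ 8 * -Real.log ε + 4 * √2 * π)
    nlinarith
  have h3 : 4 * π + 8 * -Real.log ε + 4 * √2 * π ≤ 8 * (-Real.log ε + 4) := by
    have hs : √2 ≤ 1.42 := by
      rw [Real.sqrt_le_left (by norm_num)]; norm_num
    have := pi_lt_d2
    nlinarith
  calc 1 / (4 * π) * (HL fun x => m x 2).toReal
      ≤ 1 / (4 * π) * (8 * (-Real.log ε + 4) * Eloc ε m) := by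
        refine mul_le_mul_of_nonneg_left (h2.trans ?_) (by positivity)
        exact mul_le_mul_of_nonneg_right h3 hE
    _ = _ := by field_simp; ring

lemma Mag.Fen_ge {m : R2 → R3} (hm : Mag m) (ε : ℝ) (h0 : 0 < ε) (h1 : ε < 1) (lam : ℝ)
    (hl : 0 ≤ lam) (hl2 : lam ≤ π / 2 * (1 - 4 / -Real.log ε)) :
    16 / (-Real.log ε) ^ 2 * Eloc ε m ≤ Fen ε lam m := by
  have hlog := Real.log_neg h0 h1
  have hL : 0 < -Real.log ε := by linarith
  unfold Fen
  rw [abs_of_neg hlog]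
  change _ ≤ Eloc ε m - _
  have hE := hm.E_nonneg ε h0
  have hH := hm.H12_le ε h0 h1
  have a1 : lam / -Real.log ε * H12 (fun x => m x 2) ≤
      lam / -Real.log ε * (2 / π * (-Real.log ε + 4) * Eloc ε m) :=
    mul_le_mul_of_nonneg_left hH (by positivity)
  have a2 : lam / -Real.log ε * (2 / π * (-Real.log ε + 4) * Eloc ε m) ≤
      (π / 2 * (1 - 4 / -Real.log ε)) / -Real.log ε * (2 / π * (-Real.log ε + 4) * Eloc ε m) := by
    have := pi_pos
    gcongr
  have a3 : (π / 2 * (1 - 4 / -Real.log ε)) / -Real.log ε * (2 / π * (-Real.log ε + 4) * Eloc ε m)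
      = Eloc ε m - 16 / (-Real.log ε) ^ 2 * Eloc ε m := by
    have := pi_pos
    generalize -Real.log ε = L at *
    field_simp; ring
  linarith

lemma Mag.const_of_E {m : R2 → R3} (hm : Mag m) (ε : ℝ) (h0 : 0 < ε) (hE : Eloc ε m = 0) :
    (∀ x, m x = e3) ∨ (∀ x, m x = -e3) := by
  have hnn : ∀ x, 0 ≤ ε / 2 * gradVSq m x + (1 - (m x 2) ^ 2) / (2 * ε) := fun x => by
    have h2 := gradVSq_nonneg m x
    have h3 := hm.one_sub x
    positivity
  have hz := (integral_eq_zero_iff_of_nonneg hnn (integrable_cube (hm.cont_dens ε))).1 hE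
  have hz2 := Measure.eqOn_of_ae_eq hz (hm.cont_dens ε).continuousOn continuousOn_const (by
    unfold cube
    rw [interior_pi_set Set.finite_univ, closure_pi_set]
    refine Set.pi_mono fun i _ => ?_
    rw [interior_Ico, closure_Ioo (by norm_num)]
    exact Set.Ico_subset_Icc_self)
  have hsq : ∀ x, m x 2 ^ 2 = 1 := by
    intro x
    set w : R2 := fun i => Int.fract (x i) with hw
    have hxw : m x = m w := by
      rw [← hm.2.1 w (fun i => ⌊x i⌋)]
      congr 1; ext i; simp [hw, Int.fract_add_floor]
    have hwc : w ∈ cube := fun i _ => ⟨Int.fract_nonneg _, Int.fract_lt_one _⟩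
    have h := hz2 hwc
    simp only [Pi.zero_apply] at h
    have h2 : 0 ≤ ε / 2 * gradVSq m w := by have := gradVSq_nonneg m w; positivity
    have h3 := hm.one_sub w
    have h4 : (1 - (m w 2) ^ 2) / (2 * ε) = 0 :=
      le_antisymm (by linarith) (by positivity)
    rw [div_eq_zero_iff] at h4
    rw [hxw]
    rcases h4 with h4 | h4 <;> linarith
  have hz0 : ∀ x, m x 0 = 0 := fun x => by
    have := hm.sum x
    have := hsq x
    have : m x 0 ^ 2 = 0 := le_antisymm (by nlinarith [sq_nonneg (m x 1)]) (sq_nonneg _)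
    exact pow_eq_zero_iff two_ne_zero |>.1 this
  have hz1 : ∀ x, m x 1 = 0 := fun x => by
    have := hm.sum x
    have := hsq x
    have : m x 1 ^ 2 = 0 := le_antisymm (by nlinarith [sq_nonneg (m x 0)]) (sq_nonneg _)
    exact pow_eq_zero_iff two_ne_zero |>.1 this
  have hc := (hm.contDiff 2).continuous
  have := isPreconnected_univ.eq_or_eq_neg_of_sq_eq (f := fun x => m x 2) (g := fun _ => (1:ℝ))
    hc.continuousOn continuousOn_const (fun x _ => by simp [hsq x]) (fun _ => one_ne_zero)
  rcases this with h | h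
  · left; intro x; ext i
    have := h (Set.mem_univ x)
    fin_cases i
    · simpa [e3] using hz0 x
    · simpa [e3] using hz1 x
    · simpa [e3] using this
  · right; intro x; ext i
    have := h (Set.mem_univ x)
    fin_cases i
    · simpa [e3] using hz0 x
    · simpa [e3] using hz1 x
    · simpa [e3] using this

lemma Fen_const (ε lam : ℝ) (m : R2 → R3) (c : R3) (hc : c 2 ^ 2 = 1) (h : ∀ x, m x = c) :
    Fen ε lam m = 0 := by
  obtain rfl : m = fun _ => c := funext h
  simp [Fen, H12, gradVSq, hc]

/-! ### The competitor -/

/-- Rescaled phase. -/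
def ph (ε t : ℝ) : ℝ := sin (2 * π * t) / (2 * π) / ε

/-- Wall profile. -/
def Fp (ε t : ℝ) : ℝ := sinh (ph ε t) / cosh (ph ε t)

/-- The competitor. -/
def mcomp (ε : ℝ) (x : R2) : R3 := ![1 / cosh (ph ε (x 0)), 0, Fp ε (x 0)]

lemma ph_deriv (ε t : ℝ) : HasDerivAt (ph ε) (cos (2 * π * t) / ε) t := by
  have h1 : HasDerivAt (fun t : ℝ => 2 * π * t) (2 * π) t := by
    simpa using (hasDerivAt_id t).const_mul (2 * π)
  have h2 := ((h1.sin).div_const (2 * π)).div_const ε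
  have : cos (2 * π * t) * (2 * π) / (2 * π) = cos (2 * π * t) := by
    have := pi_pos; field_simp
  rw [this] at h2
  exact h2

lemma Fp_deriv (ε t : ℝ) :
    HasDerivAt (Fp ε) (cos (2 * π * t) / ε / cosh (ph ε t) ^ 2) t := by
  have h := ph_deriv ε t
  have hc := (cosh_pos (ph ε t)).ne'
  have h2 := (h.sinh).div (h.cosh) hc
  refine h2.congr_deriv ?_
  have := cosh_sq (ph ε t)
  congr 1
  linear_combination (cos (2 * π * t) / ε) * this

lemma sech_deriv (ε t : ℝ) :
    HasDerivAt (fun t => 1 / cosh (ph ε t))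
      (-(sinh (ph ε t) * (cos (2 * π * t) / ε)) / cosh (ph ε t) ^ 2) t := by
  have h := ph_deriv ε t
  have hc := (cosh_pos (ph ε t)).ne'
  have h2 := (hasDerivAt_const t (1:ℝ)).div (h.cosh) hc
  refine h2.congr_deriv ?_
  congr 1; ring

lemma ph_contDiff (ε : ℝ) : ContDiff ℝ 1 (ph ε) := by
  unfold ph; fun_prop

lemma ph_cont (ε : ℝ) : Continuous (ph ε) := (ph_contDiff ε).continuous

lemma Fp_cont (ε : ℝ) : Continuous (Fp ε) :=
  continuous_iff_continuousAt.2 fun t => (Fp_deriv ε t).continuousAt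

lemma ph_int (ε t : ℝ) (n : ℤ) : ph ε (t + n) = ph ε t := by
  unfold ph
  rw [show 2 * π * (t + n) = 2 * π * t + n * (2 * π) by ring, sin_add_int_mul_two_pi]

lemma mcomp_mag (ε : ℝ) : Mag (mcomp ε) := by
  refine ⟨?_, ?_, ?_⟩
  · rw [contDiff_pi]
    have hp : ContDiff ℝ 1 fun x : R2 => ph ε (x 0) := (ph_contDiff ε).comp (contDiff_apply ℝ ℝ 0)
    have hc : ContDiff ℝ 1 fun x : R2 => cosh (ph ε (x 0)) := hp.cosh
    intro i
    fin_cases i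
    · exact contDiff_const.div hc fun x => (cosh_pos _).ne'
    · exact contDiff_const
    · exact hp.sinh.div hc fun x => (cosh_pos _).ne'
  · intro x n
    simp only [mcomp, Fp, Pi.add_apply, ph_int]
  · intro x
    have hc := (cosh_pos (ph ε (x 0))).ne'
    have := cosh_sq (ph ε (x 0))
    simp only [mcomp, Fp, Fin.sum_univ_three, Matrix.cons_val]
    field_simp
    linarith

lemma fd_one (G : ℝ → ℝ) (x v : R2) (d : ℝ) (h : HasDerivAt G d (x 0)) :
    fderiv ℝ (fun x : R2 => G (x 0)) x v = d * v 0 := by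
  have h2 := HasDerivAt.comp_hasFDerivAt x h (hasFDerivAt_apply (𝕜 := ℝ) (0 : Fin 2) x)
  have h3 := h2.fderiv
  change fderiv ℝ (G ∘ fun f => f 0) x v = _
  rw [h3]; simp

lemma mcomp_grad (ε : ℝ) (x : R2) : gradVSq (mcomp ε) x =
    (cos (2 * π * x 0) / ε) ^ 2 / cosh (ph ε (x 0)) ^ 2 := by
  have hm := mcomp_mag ε
  have h0 : ∀ v, fderiv ℝ (mcomp ε) x v 0 =
      (-(sinh (ph ε (x 0)) * (cos (2 * π * x 0) / ε)) / cosh (ph ε (x 0)) ^ 2) * v 0 := fun v => by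
    rw [hm.fd]; exact fd_one (fun t => 1 / cosh (ph ε t)) x v _ (sech_deriv ε (x 0))
  have h1 : ∀ v, fderiv ℝ (mcomp ε) x v 1 = 0 := fun v => by
    rw [hm.fd]
    have := fd_one (fun _ => 0) x v 0 (hasDerivAt_const _ _)
    rw [zero_mul] at this; exact this
  have h2 : ∀ v, fderiv ℝ (mcomp ε) x v 2 =
      (cos (2 * π * x 0) / ε / cosh (ph ε (x 0)) ^ 2) * v 0 := fun v => by
    rw [hm.fd]; exact fd_one (Fp ε) x v _ (Fp_deriv ε (x 0))
  have hc := (cosh_pos (ph ε (x 0))).ne'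
  have hs := cosh_sq (ph ε (x 0))
  unfold gradVSq
  simp only [Fin.sum_univ_three, Fin.sum_univ_two, h0, h1, h2, Pi.single_eq_same]
  rw [Pi.single_eq_of_ne (by decide : (0 : Fin 2) ≠ 1)]
  generalize cos (2 * π * x 0) / ε = c
  generalize sinh (ph ε (x 0)) = S at *
  generalize cosh (ph ε (x 0)) = C at *
  field_simp
  linear_combination (-c ^ 2) * hs

lemma cube_proj : MeasurePreserving (fun x : R2 => x 0) (volume.restrict cube)
    (volume.restrict (Set.Ico (0:ℝ) 1)) := by
  have : IsProbabilityMeasure ((volume : Measure ℝ).restrict (Set.Ico (0:ℝ) 1)) := ⟨by simp⟩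
  have h := measurePreserving_eval
    (fun _ : Fin 2 => (volume : Measure ℝ).restrict (Set.Ico (0:ℝ) 1)) 0
  rw [← Measure.restrict_pi_pi] at h
  exact h

lemma sq_le_cosh (u : ℝ) : u ^ 2 ≤ cosh u ^ 2 := by
  have h : |u| ≤ cosh u := by
    rw [← cosh_abs]
    exact (self_le_sinh_iff.2 (abs_nonneg u)).trans (sinh_lt_cosh _).le
  rw [← sq_abs]
  exact pow_le_pow_left₀ (abs_nonneg u) h 2

lemma dens_le (ε : ℝ) (h0 : 0 < ε) (t : ℝ) :
    ε / 2 * ((cos (2 * π * t) / ε) ^ 2 / cosh (ph ε t) ^ 2) + (1 - (Fp ε t) ^ 2) / (2 * ε) ≤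
      |cos (2 * π * t) / ε / cosh (ph ε t) ^ 2| + 4 * π ^ 2 * ε := by
  have hu := sq_le_cosh (ph ε t)
  have hs := cosh_sq (ph ε t)
  have hC := cosh_pos (ph ε t)
  have hp := pi_pos
  have hsin : sin (2 * π * t) = 2 * π * ε * ph ε t := by unfold ph; field_simp
  have hcs := sin_sq_add_cos_sq (2 * π * t)
  have hc1 := abs_cos_le_one (2 * π * t)
  unfold Fp
  rw [abs_div, abs_div, abs_of_pos h0, abs_of_pos (pow_pos hC 2)]
  rw [hsin] at hcs
  generalize ph ε t = u at *
  generalize cos (2 * π * t) = c at *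
  generalize cosh u = C at *
  generalize sinh u = S at *
  have hcc : c ^ 2 = |c| ^ 2 := (sq_abs c).symm
  have hc0 := abs_nonneg c
  have hS : 1 - (S / C) ^ 2 = 1 / C ^ 2 := by field_simp; linarith
  rw [hS]
  have e : ε / 2 * ((c / ε) ^ 2 / C ^ 2) + 1 / C ^ 2 / (2 * ε) - |c| / ε / C ^ 2 =
      (1 - |c|) ^ 2 / 2 / (ε * C ^ 2) := by
    rw [div_pow, hcc]; field_simp; ring
  have e2 : (1 - |c|) ^ 2 / 2 / (ε * C ^ 2) ≤ 4 * π ^ 2 * ε := by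
    rw [div_le_iff₀ (by positivity)]
    have : (1 - |c|) ^ 2 / 2 ≤ (2 * π * ε * u) ^ 2 := by nlinarith
    have h3 : (2 * π * ε * u) ^ 2 ≤ (2 * π * ε) ^ 2 * C ^ 2 := by
      rw [mul_pow]; exact mul_le_mul_of_nonneg_left hu (by positivity)
    nlinarith
  linarith

lemma Fp_abs (ε t : ℝ) : |Fp ε t| ≤ 1 := by
  rw [← sq_le_one_iff_abs_le_one]
  unfold Fp
  rw [div_pow, div_le_one (pow_pos (cosh_pos _) 2), cosh_sq]; linarith

lemma int_Fp_abs (ε : ℝ) (h0 : 0 < ε) :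
    ∫ t in (0:ℝ)..1, |cos (2 * π * t) / ε / cosh (ph ε t) ^ 2| ≤ 4 := by
  have hp := pi_pos
  set d : ℝ → ℝ := fun t => cos (2 * π * t) / ε / cosh (ph ε t) ^ 2 with hd
  have hdc : Continuous d := by
    refine Continuous.div (by fun_prop) ?_ fun t => (pow_pos (cosh_pos _) 2).ne'
    exact (continuous_cosh.comp (ph_cont ε)).pow 2
  have hi : ∀ a b, IntervalIntegrable (fun t => |d t|) volume a b :=
    fun a b => hdc.abs.intervalIntegrable a b
  have hF : ∀ a b, ∫ t in a..b, d t = Fp ε b - Fp ε a := fun a b =>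
    intervalIntegral.integral_eq_sub_of_hasDerivAt (fun t _ => Fp_deriv ε t)
      (hdc.intervalIntegrable a b)
  have hsgn : ∀ t, 0 ≤ cos (2 * π * t) → |d t| = d t := fun t h =>
    abs_of_nonneg (by have := cosh_pos (ph ε t); simp only [hd]; positivity)
  have hsgn2 : ∀ t, cos (2 * π * t) ≤ 0 → |d t| = -d t := fun t h => by
    refine abs_of_nonpos ?_
    have := cosh_pos (ph ε t)
    exact div_nonpos_of_nonpos_of_nonneg (div_nonpos_of_nonpos_of_nonneg h h0.le) (by positivity)
  have e1 : ∫ t in (0:ℝ)..(1/4), |d t| = Fp ε (1/4) - Fp ε 0 := by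
    rw [← hF]
    refine intervalIntegral.integral_congr fun t ht => ?_
    rw [Set.uIcc_of_le (by norm_num)] at ht
    exact hsgn t (cos_nonneg_of_mem_Icc ⟨by nlinarith [ht.1], by nlinarith [ht.2]⟩)
  have e2 : ∫ t in (1/4:ℝ)..(3/4), |d t| = -(Fp ε (3/4) - Fp ε (1/4)) := by
    rw [← hF, ← intervalIntegral.integral_neg]
    refine intervalIntegral.integral_congr fun t ht => ?_
    rw [Set.uIcc_of_le (by norm_num)] at ht
    exact hsgn2 t (cos_nonpos_of_pi_div_two_le_of_le (by nlinarith [ht.1]) (by nlinarith [ht.2]))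
  have e3 : ∫ t in (3/4:ℝ)..1, |d t| = Fp ε 1 - Fp ε (3/4) := by
    rw [← hF]
    refine intervalIntegral.integral_congr fun t ht => ?_
    rw [Set.uIcc_of_le (by norm_num)] at ht
    refine hsgn t ?_
    rw [← cos_sub_two_pi]
    exact cos_nonneg_of_mem_Icc ⟨by nlinarith [ht.1], by nlinarith [ht.2]⟩
  have e4 : Fp ε 1 = Fp ε 0 := by
    have := ph_int ε 0 1
    simp only [Int.cast_one, zero_add] at this
    simp only [Fp, this]
  rw [← intervalIntegral.integral_add_adjacent_intervals (hi 0 (3/4)) (hi (3/4) 1),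
    ← intervalIntegral.integral_add_adjacent_intervals (hi 0 (1/4)) (hi (1/4) (3/4)), e1, e2, e3, e4]
  have := abs_le.1 (Fp_abs ε (1/4))
  have := abs_le.1 (Fp_abs ε (3/4))
  linarith

lemma Eloc_le (ε : ℝ) (h0 : 0 < ε) : Eloc ε (mcomp ε) ≤ 4 + 4 * π ^ 2 * ε := by
  have hC2 : Continuous fun t => cosh (ph ε t) ^ 2 := (continuous_cosh.comp (ph_cont ε)).pow 2
  have hF := Fp_cont ε
  have hne : ∀ t, cosh (ph ε t) ^ 2 ≠ 0 := fun t => (pow_pos (cosh_pos _) 2).ne'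
  have hc1 : Continuous fun t => ε / 2 * ((cos (2 * π * t) / ε) ^ 2 / cosh (ph ε t) ^ 2) +
      (1 - (Fp ε t) ^ 2) / (2 * ε) :=
    (continuous_const.mul (Continuous.div (by fun_prop) hC2 hne)).add (by fun_prop)
  have hc2 : Continuous fun t => |cos (2 * π * t) / ε / cosh (ph ε t) ^ 2| :=
    (Continuous.div (by fun_prop) hC2 hne).abs
  have e : Eloc ε (mcomp ε) = ∫ t in (0:ℝ)..1,
      (ε / 2 * ((cos (2 * π * t) / ε) ^ 2 / cosh (ph ε t) ^ 2) + (1 - (Fp ε t) ^ 2) / (2 * ε)) := by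
    unfold Eloc
    rw [intervalIntegral.integral_of_le zero_le_one, integral_Ioc_eq_integral_Ioo,
      ← integral_Ico_eq_integral_Ioo, ← cube_proj.map_eq, integral_map]
    · refine integral_congr_ae (Eventually.of_forall fun x => ?_)
      simp only [mcomp_grad]
      simp [mcomp]
    · exact cube_proj.measurable.aemeasurable
    · exact hc1.aestronglyMeasurable
  rw [e]
  calc _ ≤ ∫ t in (0:ℝ)..1, (|cos (2 * π * t) / ε / cosh (ph ε t) ^ 2| + 4 * π ^ 2 * ε) := by
        refine intervalIntegral.integral_mono_on zero_le_one (hc1.intervalIntegrable _ _)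
          ((hc2.add continuous_const).intervalIntegrable _ _) fun t _ => dens_le ε h0 t
    _ ≤ _ := by
        rw [intervalIntegral.integral_add (hc2.intervalIntegrable _ _)
          (continuous_const.intervalIntegrable _ _)]
        have := int_Fp_abs ε h0
        simp
        linarith

/-! ### Lower bound for the nonlocal term of the competitor -/

lemma deriv_b (a : ℝ) (ha : a ≠ 0) (b : ℝ) :
    HasDerivAt (fun b => b / (a ^ 2 * √(a ^ 2 + b ^ 2))) (1 / √(a ^ 2 + b ^ 2) ^ 3) b := by
  have hp : 0 < a ^ 2 + b ^ 2 := by positivity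
  have h1 : HasDerivAt (fun b : ℝ => a ^ 2 + b ^ 2) (2 * b) b := by
    simpa using (hasDerivAt_pow 2 b).const_add (a ^ 2)
  have h2 := (h1.sqrt hp.ne').const_mul (a ^ 2)
  have hs : 0 < √(a ^ 2 + b ^ 2) := Real.sqrt_pos.2 hp
  have h3 := (hasDerivAt_id b).div h2 (by positivity)
  refine h3.congr_deriv ?_
  have hq := Real.sq_sqrt hp.le
  generalize √(a ^ 2 + b ^ 2) = s at *
  simp only [id]
  field_simp
  nlinarith

lemma lint_b (a : ℝ) (ha : a ≠ 0) :
    ENNReal.ofReal (2 / a ^ 2) ≤ ∫⁻ b : ℝ, ENNReal.ofReal (1 / √(a ^ 2 + b ^ 2) ^ 3) := by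
  have key : ∀ R : ℝ, 0 < R → ENNReal.ofReal (2 / a ^ 2 * (R / (|a| + R))) ≤
      ∫⁻ b : ℝ, ENNReal.ofReal (1 / √(a ^ 2 + b ^ 2) ^ 3) := by
    intro R hR
    have hI : ∫ b in (-R)..R, 1 / √(a ^ 2 + b ^ 2) ^ 3 =
        2 / a ^ 2 * (R / √(a ^ 2 + R ^ 2)) := by
      rw [intervalIntegral.integral_eq_sub_of_hasDerivAt (fun b _ => deriv_b a ha b)]
      · rw [neg_sq, neg_div, sub_neg_eq_add]
        have : √(a ^ 2 + R ^ 2) ≠ 0 := (Real.sqrt_pos.2 (by positivity)).ne'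
        field_simp; ring
      · refine Continuous.intervalIntegrable ?_ _ _
        refine continuous_const.div (by fun_prop) fun b => ?_
        exact pow_ne_zero _ (Real.sqrt_pos.2 (by positivity)).ne'
    have hle : √(a ^ 2 + R ^ 2) ≤ |a| + R := by
      refine Real.sqrt_le_iff.2 ⟨by positivity, ?_⟩
      nlinarith [abs_nonneg a, sq_abs a]
    calc ENNReal.ofReal (2 / a ^ 2 * (R / (|a| + R)))
        ≤ ENNReal.ofReal (2 / a ^ 2 * (R / √(a ^ 2 + R ^ 2))) := by
          refine ENNReal.ofReal_le_ofReal ?_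
          have : 0 < √(a ^ 2 + R ^ 2) := Real.sqrt_pos.2 (by positivity)
          gcongr
      _ = ENNReal.ofReal (∫ b in Set.Ioc (-R) R, 1 / √(a ^ 2 + b ^ 2) ^ 3) := by
          rw [← hI, intervalIntegral.integral_of_le (by linarith)]
      _ ≤ ∫⁻ b in Set.Ioc (-R) R, ENNReal.ofReal (1 / √(a ^ 2 + b ^ 2) ^ 3) := ofReal_int_le _ _
      _ ≤ _ := setLIntegral_le_lintegral _ _
  have ht : Tendsto (fun R : ℝ => ENNReal.ofReal (2 / a ^ 2 * (R / (|a| + R)))) atTop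
      (nhds (ENNReal.ofReal (2 / a ^ 2))) := by
    refine (ENNReal.continuous_ofReal.tendsto _).comp ?_
    have h1 : Tendsto (fun R : ℝ => |a| / (|a| + R)) atTop (nhds 0) :=
      tendsto_const_nhds.div_atTop (tendsto_atTop_add_const_left _ _ tendsto_id)
    have h2 := (h1.const_sub 1).const_mul (2 / a ^ 2)
    rw [sub_zero, mul_one] at h2
    refine h2.congr' ?_
    filter_upwards [eventually_gt_atTop 0] with R hR
    have : |a| + R ≠ 0 := by positivity
    congr 1
    field_simp; ring
  exact le_of_tendsto ht ((eventually_gt_atTop 0).mono key)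

/-- One-dimensional kernel. -/
def Kr (F : ℝ → ℝ) (t u : ℝ) : ENNReal := ENNReal.ofReal ((F u - F t) ^ 2 * (2 / (u - t) ^ 2))

lemma Kr_meas {F : ℝ → ℝ} (hF : Continuous F) : Measurable (Function.uncurry (Kr F)) := by
  unfold Kr Function.uncurry
  have := hF.measurable
  fun_prop

lemma inner_ge {F : ℝ → ℝ} (hF : Continuous F) (t : ℝ) :
    ∫⁻ u, Kr F t u ≤
      ∫⁻ z : R2, ENNReal.ofReal ((F (t + z 0) - F t) ^ 2 / en2 z ^ 3) := by
  have hFm := hF.measurable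
  rw [lint_two, Measure.volume_eq_prod, lintegral_prod]
  swap
  · refine Measurable.aemeasurable ?_
    simp only [Matrix.cons_val_zero, en2, Fin.sum_univ_two, Matrix.cons_val_one]
    fun_prop
  rw [← lintegral_add_left_eq_self _ t]
  refine lintegral_mono fun a => ?_
  simp only [Kr, Matrix.cons_val_zero, en2, Fin.sum_univ_two, Matrix.cons_val_one, add_sub_cancel_left]
  by_cases ha : a = 0
  · simp [ha]
  rw [ENNReal.ofReal_mul (sq_nonneg _)]
  refine (mul_le_mul_right (lint_b a ha) _).trans ?_
  rw [← lintegral_const_mul _ (by fun_prop)]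
  refine lintegral_mono fun b => ?_
  rw [← ENNReal.ofReal_mul (sq_nonneg _), mul_one_div]

lemma HL_ge_one {F : ℝ → ℝ} (hF : Continuous F) :
    ∫⁻ t in Set.Ico (0:ℝ) 1, ∫⁻ u, Kr F t u ≤ HL (fun x => F (x 0)) := by
  have hG : Measurable fun t => ∫⁻ u, Kr F t u := (Kr_meas hF).lintegral_prod_right'
  rw [← cube_proj.lintegral_comp hG]
  exact lintegral_mono fun x => inner_ge hF (x 0)

/-- Quarter-period interaction. -/
def Qq (F : ℝ → ℝ) (ε : ℝ) : ENNReal :=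
  ∫⁻ a in Set.Ioo ε (1/4), ∫⁻ b in Set.Ioo ε (1/4),
    ENNReal.ofReal ((F a + F b) ^ 2 * (2 / (a + b) ^ 2))

lemma piece {F : ℝ → ℝ} (ε : ℝ) (τ ρ : ℝ → ℝ)
    (hτ : MeasurePreserving τ) (hτe : MeasurableEmbedding τ)
    (hρ : MeasurePreserving ρ) (hρe : MeasurableEmbedding ρ) (S : Set ℝ)
    (hS : τ ⁻¹' S = Set.Ioo ε (1/4))
    (hK : ∀ a b, (F (ρ b) - F (τ a)) ^ 2 = (F a + F b) ^ 2 ∧ (ρ b - τ a) ^ 2 = (a + b) ^ 2) :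
    Qq F ε ≤ ∫⁻ t in S, ∫⁻ u, Kr F t u := by
  rw [← hτ.setLIntegral_comp_preimage_emb hτe, hS]
  refine lintegral_mono fun a => ?_
  rw [← hρ.lintegral_comp_emb hρe]
  refine (setLIntegral_le_lintegral _ _).trans (lintegral_mono fun b => ?_)
  simp only [Kr, (hK a b).1, (hK a b).2]; exact le_rfl

lemma HL_ge_four {F : ℝ → ℝ} (hF : Continuous F) (ε : ℝ) (h0 : 0 < ε)
    (hodd : ∀ t, F (-t) = -F t) (hhalf : ∀ t, F (1/2 + t) = -F t) :
    4 * Qq F ε ≤ HL (fun x => F (x 0)) := by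
  have hh2 : ∀ t, F (1/2 - t) = F t := fun t => by
    rw [sub_eq_add_neg, hhalf, hodd, neg_neg]
  have hone : ∀ t, F (1 + t) = F t := fun t => by
    rw [show 1 + t = 1/2 + (1/2 + t) by ring, hhalf, hhalf, neg_neg]
  have hone2 : ∀ t, F (1 - t) = -F t := fun t => by
    rw [sub_eq_add_neg, hone, hodd]
  have mp := fun c : ℝ => measurePreserving_add_left (volume : Measure ℝ) c
  have mm := fun c : ℝ => Measure.measurePreserving_sub_left (volume : Measure ℝ) c
  have ep := fun c : ℝ => measurableEmbedding_addLeft c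
  have em : ∀ c : ℝ, MeasurableEmbedding fun x : ℝ => c - x :=
    fun c => (Homeomorph.subLeft c).measurableEmbedding
  have q1 := piece (F := F) ε (fun x => 0 + x) (fun x => 0 - x) (mp 0) (ep 0) (mm 0) (em 0)
    (Set.Ioo ε (1/4)) (by ext x; simp) (fun a b => by
      simp only [zero_add, zero_sub, hodd]; constructor <;> ring)
  have q2 := piece (F := F) ε (fun x => 1/2 - x) (fun x => 1/2 + x) (mm _) (em _) (mp _) (ep _)
    (Set.Ioo (1/4) (1/2 - ε)) (by
      ext x; simp only [Set.mem_preimage, Set.mem_Ioo]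
      constructor <;> rintro ⟨h, h'⟩ <;> constructor <;> linarith) (fun a b => by
      simp only [hh2, hhalf]; constructor <;> ring)
  have q3 := piece (F := F) ε (fun x => 1/2 + x) (fun x => 1/2 - x) (mp _) (ep _) (mm _) (em _)
    (Set.Ioo (1/2 + ε) (3/4)) (by
      ext x; simp only [Set.mem_preimage, Set.mem_Ioo]
      constructor <;> rintro ⟨h, h'⟩ <;> constructor <;> linarith) (fun a b => by
      simp only [hh2, hhalf]; constructor <;> ring)
  have q4 := piece (F := F) ε (fun x => 1 - x) (fun x => 1 + x) (mm _) (em _) (mp _) (ep _)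
    (Set.Ioo (3/4) (1 - ε)) (by
      ext x; simp only [Set.mem_preimage, Set.mem_Ioo]
      constructor <;> rintro ⟨h, h'⟩ <;> constructor <;> linarith) (fun a b => by
      simp only [hone, hone2]; constructor <;> ring)
  refine le_trans ?_ (HL_ge_one hF)
  have hsub : (Set.Ioo ε (1/4) ∪ Set.Ioo (1/4) (1/2 - ε)) ∪
      (Set.Ioo (1/2 + ε) (3/4) ∪ Set.Ioo (3/4) (1 - ε)) ⊆ Set.Ico (0:ℝ) 1 := by
    rintro x ((⟨h, h'⟩ | ⟨h, h'⟩) | (⟨h, h'⟩ | ⟨h, h'⟩)) <;> constructor <;> linarith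
  refine le_trans ?_ (lintegral_mono_set hsub)
  rw [lintegral_union (by measurability), lintegral_union (by measurability),
    lintegral_union (by measurability)]
  · calc 4 * Qq F ε = (Qq F ε + Qq F ε) + (Qq F ε + Qq F ε) := by ring
      _ ≤ _ := by gcongr
  all_goals
    rw [Set.disjoint_left]
  · rintro x ⟨h, h'⟩ ⟨h2, h2'⟩; linarith
  · rintro x ⟨h, h'⟩ ⟨h2, h2'⟩; linarith
  · rintro x (⟨h, h'⟩ | ⟨h, h'⟩) (⟨h2, h2'⟩ | ⟨h2, h2'⟩) <;> linarith

lemma Fp_odd (ε t : ℝ) : Fp ε (-t) = -Fp ε t := by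
  have : ph ε (-t) = -ph ε t := by
    unfold ph; rw [mul_neg, sin_neg]; ring
  simp only [Fp, this, sinh_neg, cosh_neg]; ring

lemma Fp_half (ε t : ℝ) : Fp ε (1/2 + t) = -Fp ε t := by
  have : ph ε (1/2 + t) = -ph ε t := by
    unfold ph
    rw [show 2 * π * (1/2 + t) = 2 * π * t + π by ring, sin_add_pi]; ring
  simp only [Fp, this, sinh_neg, cosh_neg]; ring

lemma tanh_ge (u : ℝ) (hu : 0 < u) : 1 - 1 / u ^ 2 ≤ sinh u / cosh u := by
  have hc := cosh_pos u
  have h1 := cosh_sub_sinh u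
  have h2 := quadratic_le_exp_of_nonneg (x := 2 * u) (by positivity)
  have hE : exp (-u) * exp (2 * u) = exp u := by rw [← exp_add]; congr 1; ring
  have hcc : 2 * cosh u = exp u + exp (-u) := by rw [cosh_eq]; ring
  have he := exp_pos (-u)
  have h3 : exp (-u) * u ^ 2 ≤ cosh u := by nlinarith
  have : sinh u / cosh u = 1 - exp (-u) / cosh u := by rw [← h1]; field_simp; ring
  rw [this]
  have : exp (-u) / cosh u ≤ 1 / u ^ 2 := by
    rw [div_le_div_iff₀ hc (by positivity)]; linarith
  linarith

lemma Fp_ge (ε a : ℝ) (h0 : 0 < ε) (ha : 0 < a) (ha4 : a ≤ 1/4) :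
    1 - π ^ 2 * ε ^ 2 / (4 * a ^ 2) ≤ Fp ε a := by
  have hpi := pi_pos
  have hs := Real.mul_le_sin (x := 2 * π * a) (by positivity) (by nlinarith)
  have hs2 : 4 * a ≤ sin (2 * π * a) := by
    refine le_trans (le_of_eq ?_) hs; field_simp; ring
  have hu : 2 * a / π / ε ≤ ph ε a := by
    unfold ph
    gcongr ?_ / ε
    rw [div_le_div_iff₀ hpi (by positivity)]; nlinarith
  have hup : 0 < 2 * a / π / ε := by positivity
  refine le_trans ?_ (tanh_ge (ph ε a) (hup.trans_le hu))
  have : 1 / ph ε a ^ 2 ≤ 1 / (2 * a / π / ε) ^ 2 := by gcongr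
  refine (sub_le_sub_left this 1).trans' (le_of_eq ?_)
  field_simp; ring

lemma integrand_ge (ε a b : ℝ) (h0 : 0 < ε) (ha : 0 < a) (ha4 : a ≤ 1/4) (hb : 0 < b)
    (hb4 : b ≤ 1/4) :
    8 / (a + b) ^ 2 - 2 * π ^ 2 * ε ^ 2 / (a ^ 2 * b ^ 2) ≤
      (Fp ε a + Fp ε b) ^ 2 * (2 / (a + b) ^ 2) := by
  have h1 := Fp_ge ε a h0 ha ha4
  have h2 := Fp_ge ε b h0 hb hb4
  set c := π ^ 2 * ε ^ 2 with hc
  have hcp : 0 < c := by have := pi_pos; positivity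
  set s := Fp ε a + Fp ε b with hs
  have hs2 : 4 - s ^ 2 ≤ 4 * (c / (4 * a ^ 2) + c / (4 * b ^ 2)) := by
    nlinarith [sq_nonneg (s - 2)]
  have e : 4 * (c / (4 * a ^ 2) + c / (4 * b ^ 2)) * (2 / (a + b) ^ 2) ≤ 2 * c / (a ^ 2 * b ^ 2) := by
    have : 4 * (c / (4 * a ^ 2) + c / (4 * b ^ 2)) * (2 / (a + b) ^ 2) =
      2 * c / (a ^ 2 * b ^ 2) * ((a ^ 2 + b ^ 2) / (a + b) ^ 2) := by field_simp; ring
    rw [this]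
    refine mul_le_of_le_one_right (by positivity) ?_
    rw [div_le_one (by positivity)]; nlinarith [mul_pos ha hb]
  have h3 := mul_le_mul_of_nonneg_right hs2 (show 0 ≤ 2 / (a + b) ^ 2 by positivity)
  have h4 : 2 * π ^ 2 * ε ^ 2 / (a ^ 2 * b ^ 2) = 2 * c / (a ^ 2 * b ^ 2) := by rw [hc]; ring
  rw [h4]
  have h5 : 8 / (a + b) ^ 2 = 4 * (2 / (a + b) ^ 2) := by ring
  rw [h5]
  linarith

lemma int_inner (ε a c : ℝ) (h0 : 0 < ε) (h1 : ε < 1/4) (ha : 0 < a) :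
    ∫ b in Set.Ioo ε (1/4), (8 / (a + b) ^ 2 - c / (a ^ 2 * b ^ 2)) =
      8 * (1 / (a + ε) - 1 / (a + 1/4)) - c / a ^ 2 * (1 / ε - 4) := by
  rw [← integral_Ioc_eq_integral_Ioo, ← intervalIntegral.integral_of_le h1.le]
  have hpos : ∀ b ∈ Set.uIcc ε (1/4), 0 < b := fun b hb => by
    rw [Set.uIcc_of_le h1.le] at hb; linarith [hb.1]
  have hd : ∀ b ∈ Set.uIcc ε (1/4), HasDerivAt
      (fun b => -8 / (a + b) + c / a ^ 2 * (1 / b)) (8 / (a + b) ^ 2 - c / (a ^ 2 * b ^ 2)) b := by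
    intro b hb
    have hb0 := hpos b hb
    have e1 := (hasDerivAt_const b (-8:ℝ)).div ((hasDerivAt_id b).const_add a)
      (show a + b ≠ 0 by positivity)
    have e2 := ((hasDerivAt_const b (1:ℝ)).div (hasDerivAt_id b) hb0.ne').const_mul (c / a ^ 2)
    refine (e1.add e2).congr_deriv ?_
    simp only [id]; field_simp; ring
  rw [intervalIntegral.integral_eq_sub_of_hasDerivAt hd]
  · field_simp; ring
  · refine ContinuousOn.intervalIntegrable ?_
    refine ContinuousOn.sub ?_ ?_
    · refine continuousOn_const.div (by fun_prop) fun b hb => ?_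
      have := hpos b hb; positivity
    · refine continuousOn_const.div (by fun_prop) fun b hb => ?_
      have := hpos b hb; positivity

lemma int_outer (ε d : ℝ) (h0 : 0 < ε) (h1 : ε < 1/4) :
    ∫ a in Set.Ioo ε (1/4), (8 * (1 / (a + ε) - 1 / (a + 1/4)) - d / a ^ 2) =
      8 * (2 * log (1/4 + ε) - log (2 * ε) - log (1/2)) - d * (1 / ε - 4) := by
  rw [← integral_Ioc_eq_integral_Ioo, ← intervalIntegral.integral_of_le h1.le]
  have hpos : ∀ b ∈ Set.uIcc ε (1/4), 0 < b := fun b hb => by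
    rw [Set.uIcc_of_le h1.le] at hb; linarith [hb.1]
  have hd : ∀ b ∈ Set.uIcc ε (1/4), HasDerivAt
      (fun b => 8 * (log (b + ε) - log (b + 1/4)) + d * (1 / b))
        (8 * (1 / (b + ε) - 1 / (b + 1/4)) - d / b ^ 2) b := by
    intro b hb
    have hb0 := hpos b hb
    have e1 := ((hasDerivAt_id b).add_const ε).log (show b + ε ≠ 0 by positivity)
    have e3 := ((hasDerivAt_id b).add_const (1/4)).log (show b + 1/4 ≠ 0 by positivity)
    have e2 := ((hasDerivAt_const b (1:ℝ)).div (hasDerivAt_id b) hb0.ne').const_mul d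
    refine (((e1.sub e3).const_mul 8).add e2).congr_deriv ?_
    simp only [id]; field_simp; ring
  rw [intervalIntegral.integral_eq_sub_of_hasDerivAt hd]
  · rw [show (1:ℝ)/4 + 1/4 = 1/2 by norm_num, show ε + ε = 2 * ε by ring, add_comm ε (1/4)]
    field_simp; ring
  · refine ContinuousOn.intervalIntegrable ?_
    refine ContinuousOn.sub (ContinuousOn.mul continuousOn_const (ContinuousOn.sub ?_ ?_)) ?_
    all_goals
      refine continuousOn_const.div (by fun_prop) fun b hb => ?_
      have := hpos b hb; positivity

lemma Qq_ge (ε : ℝ) (h0 : 0 < ε) (h1 : ε < 1/4) :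
    ENNReal.ofReal (8 * (-log ε - 8)) ≤ Qq (Fp ε) ε := by
  set c := 2 * π ^ 2 * ε ^ 2 with hc
  have hinv : 4 ≤ 1 / ε := by rw [le_div_iff₀ h0]; linarith
  have step : ENNReal.ofReal (∫ a in Set.Ioo ε (1/4),
      (8 * (1 / (a + ε) - 1 / (a + 1/4)) - c * (1 / ε - 4) / a ^ 2)) ≤ Qq (Fp ε) ε := by
    refine (ofReal_int_le _ _).trans ?_
    refine setLIntegral_mono' measurableSet_Ioo fun a ha => ?_
    have ha0 : 0 < a := h0.trans ha.1
    rw [show c * (1 / ε - 4) / a ^ 2 = c / a ^ 2 * (1 / ε - 4) by ring,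
      ← int_inner ε a c h0 h1 ha0]
    refine (ofReal_int_le _ _).trans ?_
    refine setLIntegral_mono' measurableSet_Ioo fun b hb => ?_
    exact ENNReal.ofReal_le_ofReal
      (integrand_ge ε a b h0 ha0 ha.2.le (h0.trans hb.1) hb.2.le)
  refine le_trans (ENNReal.ofReal_le_ofReal ?_) step
  rw [int_outer ε _ h0 h1]
  have hl1 : log (1/4) ≤ log (1/4 + ε) := Real.log_le_log (by norm_num) (by linarith)
  have hl2 : log (2 * ε) = log 2 + log ε := Real.log_mul (by norm_num) h0.ne'
  have hl3 : log (1/2) = -log 2 := by rw [one_div, Real.log_inv]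
  have hl4 : log (1/4) = -(2 * log 2) := by
    rw [show (1:ℝ)/4 = (2 ^ 2)⁻¹ by norm_num, Real.log_inv, Real.log_pow]; norm_num
  have hlog2 := Real.log_two_lt_d9
  have hb : c * (1 / ε - 4) * (1 / ε - 4) ≤ 2 * π ^ 2 := by
    have : c * (1 / ε - 4) * (1 / ε - 4) = 2 * π ^ 2 * ((1 - 4 * ε) * (1 - 4 * ε)) := by
      rw [hc]; field_simp
    rw [this]
    refine mul_le_of_le_one_right (by positivity) ?_
    nlinarith
  have hpi : π ^ 2 < 10 := by nlinarith [Real.pi_lt_d2, Real.pi_pos]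
  rw [hl2, hl3]
  linarith

lemma H12_ge (ε : ℝ) (h0 : 0 < ε) (h1 : ε < 1/4) :
    8 / π * (-log ε - 8) ≤ H12 (fun x => mcomp ε x 2) := by
  have hm := mcomp_mag ε
  have hfin := hm.HL_fin
  have hcont : Continuous fun x => mcomp ε x 2 := (hm.contDiff 2).continuous
  rw [H12_eq hcont hfin]
  have h4 : 4 * Qq (Fp ε) ε ≤ HL (fun x => mcomp ε x 2) :=
    HL_ge_four (Fp_cont ε) ε h0 (Fp_odd ε) (Fp_half ε)
  have h5 : ENNReal.ofReal (4 * (8 * (-log ε - 8))) ≤ HL (fun x => mcomp ε x 2) := by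
    refine le_trans ?_ h4
    rw [ENNReal.ofReal_mul (by norm_num)]
    have := Qq_ge ε h0 h1
    rw [show ENNReal.ofReal 4 = 4 by norm_num]
    gcongr
  have h6 := (ENNReal.ofReal_le_iff_le_toReal hfin).1 h5
  have hpi := pi_pos
  calc 8 / π * (-log ε - 8) = 1 / (4 * π) * (4 * (8 * (-log ε - 8))) := by field_simp
    _ ≤ _ := by gcongr

/-- Theorem `th:crit-F`, item (i), cross-over of global minimizers:
below `λ₋(ε) = λ_c(1-|log β₁|/|log ε|)` the energy is nonnegative, vanishing exactly for
the constant configurations `±e₃`; above `λ₊(ε) = λ_c(1+|log β₂|/|log ε|)` the infimum of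
the energy is negative. -/
theorem stmt_16 :
    ∃ β₁ β₂ ε₀ : ℝ, 0 < β₁ ∧ β₁ < 1 ∧ 1 < β₂ ∧ 0 < ε₀ ∧ ε₀ < 1 ∧
      ∀ ε : ℝ, 0 < ε → ε < ε₀ →
        (∀ lam : ℝ, 0 ≤ lam → lam ≤ π / 2 * (1 - |Real.log β₁| / |Real.log ε|) →
          (∀ m : R2 → R3, Mag m → 0 ≤ Fen ε lam m) ∧
          (∀ m : R2 → R3, Mag m →
            (Fen ε lam m = 0 ↔ (∀ x, m x = e3) ∨ (∀ x, m x = -e3)))) ∧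
        (∀ lam : ℝ, π / 2 * (1 + |Real.log β₂| / |Real.log ε|) ≤ lam →
          ∃ m : R2 → R3, Mag m ∧ Fen ε lam m < 0) := by
  refine ⟨exp (-4), exp 40, exp (-16), exp_pos _, Real.exp_lt_one_iff.2 (by norm_num),
    one_lt_exp_iff.2 (by norm_num), exp_pos _, Real.exp_lt_one_iff.2 (by norm_num), ?_⟩
  intro ε h0 hε
  have hlog : Real.log ε < -16 := (Real.log_lt_iff_lt_exp h0).2 hε
  have h1 : ε < 1 := hε.trans (Real.exp_lt_one_iff.2 (by norm_num))
  have habs : |Real.log ε| = -Real.log ε := abs_of_neg (by linarith)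
  have hb1 : |Real.log (exp (-4))| = 4 := by rw [Real.log_exp]; norm_num
  have hb2 : |Real.log (exp 40)| = 40 := by rw [Real.log_exp]; norm_num
  rw [habs, hb1, hb2]
  set L := -Real.log ε with hL
  have hL16 : 16 < L := by linarith
  constructor
  · intro lam hl hl2
    have hge := fun (m : R2 → R3) (hm : Mag m) => hm.Fen_ge ε h0 h1 lam hl hl2
    refine ⟨fun m hm => ?_, fun m hm => ⟨fun hF => ?_, fun hc => ?_⟩⟩
    · refine le_trans ?_ (hge m hm)
      have := hm.E_nonneg ε h0
      positivity
    · refine hm.const_of_E ε h0 (le_antisymm ?_ (hm.E_nonneg ε h0))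
      have h := hge m hm
      rw [hF] at h
      have hp : 0 < 16 / (-Real.log ε) ^ 2 := by rw [← hL]; positivity
      exact nonpos_of_mul_nonpos_right h hp
    · rcases hc with hc | hc
      · exact Fen_const ε lam m e3 (by simp [e3]) hc
      · exact Fen_const ε lam m (-e3) (by simp [e3]) hc
  · intro lam hl
    refine ⟨mcomp ε, mcomp_mag ε, ?_⟩
    have hE := Eloc_le ε h0
    have hexp : L + 1 ≤ exp L := Real.add_one_le_exp L
    have hexpL : exp L = 1 / ε := by rw [hL, Real.exp_neg, Real.exp_log h0, one_div]
    have heL : ε ≤ 1 / L := by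
      rw [le_div_iff₀ (by linarith)]
      rw [hexpL, le_div_iff₀ h0] at hexp
      nlinarith
    have hH := H12_ge ε h0 (by
      have : (16:ℝ) * ε < 1 := by
        rw [le_div_iff₀ (by linarith)] at heL; nlinarith
      linarith)
    have hpi := pi_pos
    have hpi2 : π ^ 2 < 10 := by nlinarith [Real.pi_lt_d2, Real.pi_pos]
    change Eloc ε (mcomp ε) - lam / |Real.log ε| * H12 (fun x => mcomp ε x 2) < 0
    rw [habs]
    have hN : π / 2 * (1 + 40 / L) / L * (8 / π * (L - 8)) ≤
        lam / L * H12 (fun x => mcomp ε x 2) := by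
      have a1 : 0 ≤ 8 / π * (L - 8) := mul_nonneg (by positivity) (by linarith)
      have a2 : 0 ≤ lam := le_trans (by positivity) hl
      gcongr
    have hN2 : π / 2 * (1 + 40 / L) / L * (8 / π * (L - 8)) =
        4 + 128 * (1 / L) - 1280 * (1 / L) * (1 / L) := by
      have : L ≠ 0 := by linarith
      field_simp; ring
    have hi : 1 / L < 1 / 16 := by gcongr
    have hip : 0 < 1 / L := by positivity
    have hpe : 4 * π ^ 2 * ε ≤ 40 * (1 / L) := by
      calc 4 * π ^ 2 * ε ≤ 40 * ε := by gcongr; linarith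
        _ ≤ _ := by gcongr
    nlinarith
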